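/- arXiv:2305.05560 — 9 statements merged into one kernel-verified Lean document; each statement's English description precedes it below -/
import Mathlib

section
/- Let X and Y be random vectors taking values in ℝ^d (d ≥ 1) on a probability space. Suppose that for every strictly monotonically increasing measurable function u : ℝ^d → ℝ such that u∘X and u∘Y are integrable, we have E[u(X)] > E[u(Y)]. Then X distributionally dominates Y, i.e. for all v ∈ ℝ^d, F_X(v) ≤ F_Y(v), and there exists a coordinate i ∈ {1,…,d} such that the marginal X_i strictly first-order stochastically dominates Y_i. -/
open MeasureTheory
open scoped ProbabilityTheory

/-- Joint CDF of a random vector `X : Ω → Fin d → ℝ`. -/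
noncomputable def jointCDF {Ω : Type*} [MeasureSpace Ω] {d : ℕ}
    (X : Ω → Fin d → ℝ) (v : Fin d → ℝ) : ℝ :=
  (ℙ {ω | ∀ i, X ω i ≤ v i}).toReal

/-- Marginal CDF of coordinate `i` of a random vector. -/
noncomputable def margCDF {Ω : Type*} [MeasureSpace Ω] {d : ℕ}
    (X : Ω → Fin d → ℝ) (i : Fin d) (t : ℝ) : ℝ :=
  (ℙ {ω | X ω i ≤ t}).toReal

/-- `x` Pareto dominates `y`. -/
def ParetoDom {d : ℕ} (x y : Fin d → ℝ) : Prop :=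
  (∀ i, y i ≤ x i) ∧ ∃ i, y i < x i

/-- A strictly monotonically increasing function on `ℝ^d`. -/
def StrictlyMonoIncr {d : ℕ} (u : (Fin d → ℝ) → ℝ) : Prop :=
  ∀ x y : Fin d → ℝ, ParetoDom x y → u y < u x

/-- `X` first-order stochastically dominates `Y`. -/
def FSD {Ω : Type*} [MeasureSpace Ω] {d : ℕ} (X Y : Ω → Fin d → ℝ) : Prop :=
  ∀ v : Fin d → ℝ, jointCDF X v ≤ jointCDF Y v

/-- The marginal `X_i` strictly first-order stochastically dominates `Y_i`. -/
def MargStrictFSD {Ω : Type*} [MeasureSpace Ω] {d : ℕ}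
    (X Y : Ω → Fin d → ℝ) (i : Fin d) : Prop :=
  (∀ t : ℝ, margCDF X i t ≤ margCDF Y i t) ∧ ∃ t : ℝ, margCDF X i t < margCDF Y i t

/-- `X` distributionally dominates `Y`. -/
def DistDom {Ω : Type*} [MeasureSpace Ω] {d : ℕ} (X Y : Ω → Fin d → ℝ) : Prop :=
  FSD X Y ∧ ∃ i : Fin d, MargStrictFSD X Y i

/-- A bounded strictly increasing utility: the sum of the arctangents of the coordinates. -/
noncomputable def arctanSum {d : ℕ} (x : Fin d → ℝ) : ℝ := ∑ i, Real.arctan (x i)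

lemma measurable_arctanSum {d : ℕ} : Measurable (arctanSum (d := d)) := by
  unfold arctanSum
  fun_prop

lemma strictlyMonoIncr_arctanSum {d : ℕ} : StrictlyMonoIncr (arctanSum (d := d)) := by
  rintro x y ⟨hle, i, hi⟩
  exact Finset.sum_lt_sum (fun j _ => Real.arctan_strictMono.monotone (hle j))
    ⟨i, Finset.mem_univ i, Real.arctan_strictMono hi⟩

section

variable {Ω : Type*} [MeasureSpace Ω] [IsProbabilityMeasure (ℙ : Measure Ω)] {d : ℕ}

lemma integrable_arctan_comp {Z : Ω → ℝ} (hZ : Measurable Z) :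
    Integrable (fun ω => Real.arctan (Z ω)) ℙ :=
  Integrable.of_bound (Real.measurable_arctan.comp hZ).aestronglyMeasurable (Real.pi / 2)
    (Filter.Eventually.of_forall fun _ => abs_le.2
      ⟨(Real.neg_pi_div_two_lt_arctan _).le, (Real.arctan_lt_pi_div_two _).le⟩)

lemma integrable_arctanSum_comp {Z : Ω → Fin d → ℝ} (hZ : Measurable Z) :
    Integrable (fun ω => arctanSum (Z ω)) ℙ :=
  integrable_finsetSum _ fun i _ => integrable_arctan_comp ((measurable_pi_apply i).comp hZ)

/-- Utilities of the form `ε * arctanSum - 1_L`, with `L` a lower set, are strictly increasing;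
letting `ε` tend to `0` compares the probabilities of `L`. -/
lemma measureReal_preimage_le_of_isLowerSet {X Y : Ω → Fin d → ℝ}
    (hX : Measurable X) (hY : Measurable Y)
    (h : ∀ u : (Fin d → ℝ) → ℝ, Measurable u → StrictlyMonoIncr u →
      Integrable (u ∘ X) ℙ → Integrable (u ∘ Y) ℙ →
      ∫ ω, u (Y ω) ∂ℙ < ∫ ω, u (X ω) ∂ℙ)
    {L : Set (Fin d → ℝ)} (hL : IsLowerSet L) (hLm : MeasurableSet L) :
    (ℙ : Measure Ω).real (X ⁻¹' L) ≤ (ℙ : Measure Ω).real (Y ⁻¹' L) := by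
  have hind : ∀ {Z : Ω → Fin d → ℝ}, Measurable Z →
      Integrable (fun ω => L.indicator (1 : (Fin d → ℝ) → ℝ) (Z ω)) ℙ ∧
      ∫ ω, L.indicator (1 : (Fin d → ℝ) → ℝ) (Z ω) ∂ℙ = (ℙ : Measure Ω).real (Z ⁻¹' L) := by
    intro Z hZ
    have heq : (fun ω => L.indicator (1 : (Fin d → ℝ) → ℝ) (Z ω))
        = (Z ⁻¹' L).indicator (1 : Ω → ℝ) := rfl
    rw [heq]
    exact ⟨(integrable_const (1 : ℝ)).indicator (hZ hLm), integral_indicator_one (hZ hLm)⟩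
  have key : ∀ ε : ℝ, 0 < ε →
      ε * ∫ ω, arctanSum (Y ω) ∂ℙ - (ℙ : Measure Ω).real (Y ⁻¹' L) <
        ε * ∫ ω, arctanSum (X ω) ∂ℙ - (ℙ : Measure Ω).real (X ⁻¹' L) := by
    intro ε hε
    have hint : ∀ {Z : Ω → Fin d → ℝ}, Measurable Z →
        Integrable (fun ω => ε * arctanSum (Z ω)) ℙ :=
      fun hZ => (integrable_arctanSum_comp hZ).const_mul ε
    have := h (fun x => ε * arctanSum x - L.indicator (1 : (Fin d → ℝ) → ℝ) x)
      ((measurable_arctanSum.const_mul ε).sub (measurable_one.indicator hLm))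
      (fun x y hxy => by
        have h1 := mul_lt_mul_of_pos_left (strictlyMonoIncr_arctanSum x y hxy) hε
        have h2 : L.indicator (1 : (Fin d → ℝ) → ℝ) x ≤ L.indicator 1 y := by
          by_cases hx : x ∈ L
          · simp [hx, hL hxy.1 hx]
          · rw [Set.indicator_of_notMem hx]
            exact Set.indicator_nonneg (fun _ _ => zero_le_one) y
        linarith)
      ((hint hX).sub (hind hX).1) ((hint hY).sub (hind hY).1)
    rwa [integral_sub (hint hX) (hind hX).1, integral_sub (hint hY) (hind hY).1,
      (hind hX).2, (hind hY).2, integral_const_mul, integral_const_mul] at this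
  set a := ∫ ω, arctanSum (X ω) ∂ℙ
  set b := ∫ ω, arctanSum (Y ω) ∂ℙ
  by_contra! hlt
  have hc : 0 < |a - b| + 1 := by positivity
  have hδ := sub_pos.2 hlt
  set δ := (ℙ : Measure Ω).real (X ⁻¹' L) - (ℙ : Measure Ω).real (Y ⁻¹' L)
  have h1 := key (δ / (|a - b| + 1)) (div_pos hδ hc)
  have h2 : δ / (|a - b| + 1) * (a - b) ≤ δ / (|a - b| + 1) * (|a - b| + 1) :=
    mul_le_mul_of_nonneg_left ((le_abs_self _).trans (by linarith)) (div_pos hδ hc).le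
  rw [div_mul_cancel₀ _ hc.ne'] at h2
  linarith

lemma map_eq_of_margCDF_eq {X Y : Ω → Fin d → ℝ} (hX : Measurable X) (hY : Measurable Y)
    {i : Fin d} (hi : ∀ t, margCDF X i t = margCDF Y i t) :
    (ℙ : Measure Ω).map (fun ω => X ω i) = (ℙ : Measure Ω).map (fun ω => Y ω i) := by
  have hXi : Measurable fun ω => X ω i := (measurable_pi_apply i).comp hX
  have hYi : Measurable fun ω => Y ω i := (measurable_pi_apply i).comp hY
  have := Measure.isProbabilityMeasure_map (μ := (ℙ : Measure Ω)) hXi.aemeasurable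
  refine Measure.ext_of_Iic _ _ fun t => ?_
  rw [Measure.map_apply hXi measurableSet_Iic, Measure.map_apply hYi measurableSet_Iic]
  exact (ENNReal.toReal_eq_toReal_iff' (measure_ne_top _ _) (measure_ne_top _ _)).1 (hi t)

lemma integral_arctanSum_eq_of_margCDF_eq {X Y : Ω → Fin d → ℝ}
    (hX : Measurable X) (hY : Measurable Y) (heq : ∀ i t, margCDF X i t = margCDF Y i t) :
    ∫ ω, arctanSum (X ω) ∂ℙ = ∫ ω, arctanSum (Y ω) ∂ℙ := by
  have hXi : ∀ i, Measurable fun ω => X ω i := fun i => (measurable_pi_apply i).comp hX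
  have hYi : ∀ i, Measurable fun ω => Y ω i := fun i => (measurable_pi_apply i).comp hY
  unfold arctanSum
  rw [integral_finsetSum _ fun i _ => integrable_arctan_comp (hXi i),
    integral_finsetSum _ fun i _ => integrable_arctan_comp (hYi i)]
  refine Finset.sum_congr rfl fun i _ => ?_
  rw [← integral_map (hXi i).aemeasurable Real.measurable_arctan.aestronglyMeasurable,
    ← integral_map (hYi i).aemeasurable Real.measurable_arctan.aestronglyMeasurable,
    map_eq_of_margCDF_eq hX hY (heq i)]

end

/-- If every strictly monotonically increasing measurable utility (integrable against both
laws) has strictly greater expectation under `X` than under `Y`, then `X` distributionally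
dominates `Y`. -/
theorem stmt0 {Ω : Type*} [MeasureSpace Ω] [IsProbabilityMeasure (ℙ : Measure Ω)]
    {d : ℕ} (hd : 0 < d) (X Y : Ω → Fin d → ℝ)
    (hX : Measurable X) (hY : Measurable Y)
    (h : ∀ u : (Fin d → ℝ) → ℝ, Measurable u → StrictlyMonoIncr u →
      Integrable (u ∘ X) ℙ → Integrable (u ∘ Y) ℙ →
      ∫ ω, u (Y ω) ∂ℙ < ∫ ω, u (X ω) ∂ℙ) :
    DistDom X Y := by
  have hmarg : ∀ i t, margCDF X i t ≤ margCDF Y i t := fun i t =>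
    measureReal_preimage_le_of_isLowerSet hX hY h (L := {x | x i ≤ t})
      (fun _ _ hba ha => (hba i).trans ha)
      (measurableSet_le (measurable_pi_apply i) measurable_const)
  refine ⟨fun v => measureReal_preimage_le_of_isLowerSet hX hY h
    (isLowerSet_Iic v) measurableSet_Iic, ?_⟩
  by_contra hno
  have heq : ∀ i t, margCDF X i t = margCDF Y i t := fun i t =>
    (hmarg i t).antisymm (not_lt.1 fun hlt => hno ⟨i, hmarg i, t, hlt⟩)
  exact (h arctanSum measurable_arctanSum strictlyMonoIncr_arctanSum
    (integrable_arctanSum_comp hX) (integrable_arctanSum_comp hY)).ne'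
    (integral_arctanSum_eq_of_margCDF_eq hX hY heq)
end

section
/- Let X and Y be random vectors taking values in ℝ² with compactly supported laws, and suppose X distributionally dominates Y. Then for every strictly monotonically increasing, twice continuously differentiable function u : ℝ² → ℝ with ∂²u/∂x₁∂x₂(x₁,x₂) ≤ 0 for all (x₁,x₂), we have E[u(X)] > E[u(Y)]. -/
open MeasureTheory
open scoped ProbabilityTheory ENNReal

/-- Joint CDF of a random vector `X : Ω → ℝ × ℝ`. -/
noncomputable def jointCDF2 {Ω : Type*} [MeasureSpace Ω] (X : Ω → ℝ × ℝ) (v : ℝ × ℝ) : ℝ :=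
  (ℙ {ω | (X ω).1 ≤ v.1 ∧ (X ω).2 ≤ v.2}).toReal

/-- Marginal CDF of the first coordinate. -/
noncomputable def margFst {Ω : Type*} [MeasureSpace Ω] (X : Ω → ℝ × ℝ) (t : ℝ) : ℝ :=
  (ℙ {ω | (X ω).1 ≤ t}).toReal

/-- Marginal CDF of the second coordinate. -/
noncomputable def margSnd {Ω : Type*} [MeasureSpace Ω] (X : Ω → ℝ × ℝ) (t : ℝ) : ℝ :=
  (ℙ {ω | (X ω).2 ≤ t}).toReal

/-- `x` Pareto dominates `y` in `ℝ²`. -/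
def ParetoDom2 (x y : ℝ × ℝ) : Prop :=
  (y.1 ≤ x.1 ∧ y.2 ≤ x.2) ∧ (y.1 < x.1 ∨ y.2 < x.2)

/-- A strictly monotonically increasing function on `ℝ²`. -/
def StrictlyMonoIncr2 (u : ℝ × ℝ → ℝ) : Prop :=
  ∀ x y : ℝ × ℝ, ParetoDom2 x y → u y < u x

/-- `X` first-order stochastically dominates `Y`. -/
def FSD2 {Ω : Type*} [MeasureSpace Ω] (X Y : Ω → ℝ × ℝ) : Prop :=
  ∀ v : ℝ × ℝ, jointCDF2 X v ≤ jointCDF2 Y v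

/-- A univariate CDF `F` strictly first-order stochastically dominates `G`. -/
def StrictFSDcdf (F G : ℝ → ℝ) : Prop :=
  (∀ t, F t ≤ G t) ∧ ∃ t, F t < G t

/-- `X` distributionally dominates `Y`: joint FSD together with strict FSD of
some marginal. -/
def DistDom2 {Ω : Type*} [MeasureSpace Ω] (X Y : Ω → ℝ × ℝ) : Prop :=
  FSD2 X Y ∧
    (StrictFSDcdf (margFst X) (margFst Y) ∨ StrictFSDcdf (margSnd X) (margSnd Y))

open Set

section Expectation

variable {Ω E : Type*} [MeasurableSpace Ω] [MeasurableSpace E]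

lemma integrable_indicator_snd (μ : Measure Ω) [IsFiniteMeasure μ] (ν : Measure E) [SFinite ν]
    {k : E → ℝ} (hk : Integrable k ν) {A : Set (Ω × E)} (hA : MeasurableSet A) :
    Integrable (A.indicator fun p => k p.2) (μ.prod ν) :=
  (hk.comp_snd μ).indicator hA

lemma integral_indicator_snd (μ : Measure Ω) (k : E → ℝ) {A : Set (Ω × E)}
    (hA : MeasurableSet A) (e : E) :
    ∫ ω, A.indicator (fun p => k p.2) (ω, e) ∂μ = k e * μ.real {ω | (ω, e) ∈ A} := by
  have hm : MeasurableSet {ω | (ω, e) ∈ A} := measurable_prodMk_right hA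
  have : (fun ω => A.indicator (fun p => k p.2) (ω, e))
      = {ω | (ω, e) ∈ A}.indicator fun _ => k e := by
    ext ω; simp [indicator]
  simp only [this]
  rw [integral_indicator_const _ hm, smul_eq_mul, mul_comm]

lemma integral_integral_indicator_snd (μ : Measure Ω) [IsFiniteMeasure μ] (ν : Measure E)
    [SFinite ν] {k : E → ℝ} (hk : Integrable k ν) {A : Set (Ω × E)} (hA : MeasurableSet A) :
    ∫ ω, ∫ e, A.indicator (fun p => k p.2) (ω, e) ∂ν ∂μ
      = ∫ e, k e * μ.real {ω | (ω, e) ∈ A} ∂ν := by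
  rw [integral_integral_swap (f := fun ω e => A.indicator (fun p => k p.2) (ω, e))
    (integrable_indicator_snd μ ν hk hA)]
  exact integral_congr_ae (.of_forall fun e => integral_indicator_snd μ k hA e)

lemma integrable_mul_measureReal (μ : Measure Ω) [IsFiniteMeasure μ] (ν : Measure E)
    [SFinite ν] {k : E → ℝ} (hk : Integrable k ν) {A : Set (Ω × E)} (hA : MeasurableSet A) :
    Integrable (fun e => k e * μ.real {ω | (ω, e) ∈ A}) ν := by
  exact (integrable_indicator_snd μ ν hk hA).integral_prod_right.congr
    (.of_forall fun e => integral_indicator_snd μ k hA e)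

lemma measurableSet_le_snd {Z : Ω → ℝ} (hZ : Measurable Z) :
    MeasurableSet {p : Ω × ℝ | Z p.1 ≤ p.2} :=
  measurableSet_le (hZ.comp measurable_fst) measurable_snd

/-- Integration by parts expressing an expectation through the distribution function. -/
lemma integral_comp_eq_sub_integral_cdf (μ : Measure Ω) [IsProbabilityMeasure μ] {Z : Ω → ℝ}
    (hZ : Measurable Z) {a b : ℝ} (hab : ∀ᵐ ω ∂μ, Z ω ∈ Icc a b) {g g' : ℝ → ℝ}
    (hg : ∀ s, HasDerivAt g (g' s) s) (hg' : Continuous g') :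
    ∫ ω, g (Z ω) ∂μ = g b - ∫ s in Icc a b, g' s * μ.real {ω | Z ω ≤ s} := by
  have hk : Integrable g' (volume.restrict (Icc a b)) := hg'.integrableOn_Icc
  have hA := measurableSet_le_snd hZ
  have hcdf := integral_integral_indicator_snd μ _ hk hA
  simp only [mem_ofPred_eq] at hcdf
  rw [← hcdf]
  have hint := (integrable_indicator_snd μ _ hk hA).integral_prod_left
  have : ∫ ω, g (Z ω) ∂μ = ∫ ω, (g b - ∫ s in Icc a b,
      {p : Ω × ℝ | Z p.1 ≤ p.2}.indicator (fun p => g' p.2) (ω, s)) ∂μ := by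
    refine integral_congr_ae ?_
    filter_upwards [hab] with ω hω
    have h1 : (fun s => {p : Ω × ℝ | Z p.1 ≤ p.2}.indicator (fun p => g' p.2) (ω, s))
        = (Ici (Z ω)).indicator g' := by
      ext s; simp [indicator]
    have h2 : Icc a b ∩ Ici (Z ω) = Icc (Z ω) b := by
      ext s; simp only [mem_inter_iff, mem_Icc, mem_Ici]
      exact ⟨fun h => ⟨h.2, h.1.2⟩, fun h => ⟨⟨hω.1.trans h.1, h.2⟩, h.1⟩⟩
    rw [h1, setIntegral_indicator measurableSet_Ici, h2, integral_Icc_eq_integral_Ioc,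
      ← intervalIntegral.integral_of_le hω.2,
      intervalIntegral.integral_eq_sub_of_hasDerivAt (fun s _ => hg s)
        (hg'.intervalIntegrable _ _)]
    ring
  rw [this, integral_sub (integrable_const _) hint]
  simp

lemma integral_comp_sub_integral_comp (μ : Measure Ω) [IsProbabilityMeasure μ] {Z W : Ω → ℝ}
    (hZ : Measurable Z) (hW : Measurable W) {a b : ℝ} (hZab : ∀ᵐ ω ∂μ, Z ω ∈ Icc a b)
    (hWab : ∀ᵐ ω ∂μ, W ω ∈ Icc a b) {g g' : ℝ → ℝ}
    (hg : ∀ s, HasDerivAt g (g' s) s) (hg' : Continuous g') :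
    IntegrableOn (fun s => g' s * (μ.real {ω | W ω ≤ s} - μ.real {ω | Z ω ≤ s})) (Icc a b) ∧
    ∫ ω, g (Z ω) ∂μ - ∫ ω, g (W ω) ∂μ
      = ∫ s in Icc a b, g' s * (μ.real {ω | W ω ≤ s} - μ.real {ω | Z ω ≤ s}) := by
  have hk : Integrable g' (volume.restrict (Icc a b)) := hg'.integrableOn_Icc
  have iZ : IntegrableOn (fun s => g' s * μ.real {ω | Z ω ≤ s}) (Icc a b) :=
    integrable_mul_measureReal μ _ hk (measurableSet_le_snd hZ)
  have iW : IntegrableOn (fun s => g' s * μ.real {ω | W ω ≤ s}) (Icc a b) :=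
    integrable_mul_measureReal μ _ hk (measurableSet_le_snd hW)
  simp only [mul_sub]
  refine ⟨iW.sub iZ, ?_⟩
  rw [integral_comp_eq_sub_integral_cdf μ hZ hZab hg hg',
    integral_comp_eq_sub_integral_cdf μ hW hWab hg hg', integral_sub iW iZ]
  ring

lemma integral_comp_le_of_cdf_le (μ : Measure Ω) [IsProbabilityMeasure μ] {Z W : Ω → ℝ}
    (hZ : Measurable Z) (hW : Measurable W) {a b : ℝ} (hZab : ∀ᵐ ω ∂μ, Z ω ∈ Icc a b)
    (hWab : ∀ᵐ ω ∂μ, W ω ∈ Icc a b) {g g' : ℝ → ℝ}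
    (hg : ∀ s, HasDerivAt g (g' s) s) (hg' : Continuous g') (hmono : StrictMono g)
    (hle : ∀ s, μ.real {ω | Z ω ≤ s} ≤ μ.real {ω | W ω ≤ s}) :
    ∫ ω, g (W ω) ∂μ ≤ ∫ ω, g (Z ω) ∂μ := by
  rw [← sub_nonneg, (integral_comp_sub_integral_comp μ hZ hW hZab hWab hg hg').2]
  refine integral_nonneg fun s => mul_nonneg ?_ (sub_nonneg.2 (hle s))
  exact (hg s).deriv ▸ hmono.monotone.deriv_nonneg

lemma continuousWithinAt_measureReal_le (μ : Measure Ω) [IsProbabilityMeasure μ] {Z : Ω → ℝ}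
    (hZ : Measurable Z) (t : ℝ) :
    ContinuousWithinAt (fun s => μ.real {ω | Z ω ≤ s}) (Ici t) t := by
  have : IsProbabilityMeasure (μ.map Z) := Measure.isProbabilityMeasure_map hZ.aemeasurable
  have h : (fun s => μ.real {ω | Z ω ≤ s}) = ProbabilityTheory.cdf (μ.map Z) := by
    ext s
    rw [ProbabilityTheory.cdf_eq_real, map_measureReal_apply hZ measurableSet_Iic]
    rfl
  rw [h]
  exact (ProbabilityTheory.cdf (μ.map Z)).right_continuous t

lemma integral_comp_lt_of_cdf_lt (μ : Measure Ω) [IsProbabilityMeasure μ] {Z W : Ω → ℝ}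
    (hZ : Measurable Z) (hW : Measurable W) {a b : ℝ} (hZab : ∀ᵐ ω ∂μ, Z ω ∈ Icc a b)
    (hWab : ∀ᵐ ω ∂μ, W ω ∈ Icc a b) {g g' : ℝ → ℝ}
    (hg : ∀ s, HasDerivAt g (g' s) s) (hg' : Continuous g') (hmono : StrictMono g)
    (hle : ∀ s, μ.real {ω | Z ω ≤ s} ≤ μ.real {ω | W ω ≤ s})
    (hlt : ∃ t, μ.real {ω | Z ω ≤ t} < μ.real {ω | W ω ≤ t}) :
    ∫ ω, g (W ω) ∂μ < ∫ ω, g (Z ω) ∂μ := by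
  obtain ⟨t, ht⟩ := hlt
  obtain ⟨hint, heq⟩ := integral_comp_sub_integral_comp μ hZ hW hZab hWab hg hg'
  have hg0 : ∀ s, 0 ≤ g' s := fun s => (hg s).deriv ▸ hmono.monotone.deriv_nonneg
  have hat : a ≤ t := by
    by_contra! h
    have : μ.real {ω | W ω ≤ t} = 0 := by
      rw [measureReal_eq_zero_iff, ← nonpos_iff_eq_zero]
      refine (measure_mono fun ω hω => ?_).trans (ae_iff.1 hWab).le
      exact fun hm => absurd (hm.1.trans hω) (not_le.2 h)
    linarith [measureReal_nonneg (μ := μ) (s := {ω | Z ω ≤ t})]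
  have htb : t < b := by
    by_contra! h
    have : μ.real {ω | Z ω ≤ t} = 1 := by
      have h1 : {ω | Z ω ≤ t} =ᵐ[μ] univ :=
        Filter.eventuallyEq_univ.2 (hZab.mono fun ω hω => hω.2.trans h)
      rw [measureReal_congr h1, probReal_univ]
    linarith [measureReal_le_one (μ := μ) (s := {ω | W ω ≤ t})]
  obtain ⟨c, hZc, hcW⟩ := exists_between ht
  have hev := (continuousWithinAt_measureReal_le μ hZ t).eventually_lt continuousWithinAt_const hZc
  obtain ⟨e, he, hsub⟩ := (mem_nhdsGE_iff_exists_mem_Ioc_Ico_subset htb).1 hev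
  obtain ⟨r, htr, hre⟩ := exists_between he.1
  have hrb : r ≤ b := hre.le.trans he.2
  rw [← sub_pos, heq]
  have hpos : 0 < ∫ s in Icc t r, g' s * (μ.real {ω | W ω ≤ t} - c) := by
    rw [integral_mul_const, integral_Icc_eq_integral_Ioc,
      ← intervalIntegral.integral_of_le htr.le,
      intervalIntegral.integral_eq_sub_of_hasDerivAt (fun s _ => hg s)
        (hg'.intervalIntegrable _ _)]
    exact mul_pos (sub_pos.2 (hmono htr)) (sub_pos.2 hcW)
  have hss : Icc t r ⊆ Icc a b := Icc_subset_Icc hat hrb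
  refine hpos.trans_le ((setIntegral_mono_on ?_ (hint.mono_set hss) measurableSet_Icc ?_).trans
    (setIntegral_mono_set hint ?_ hss.eventuallyLE))
  · exact (hg'.mul continuous_const).integrableOn_Icc
  · intro s hs
    refine mul_le_mul_of_nonneg_left ?_ (hg0 s)
    have h1 : μ.real {ω | Z ω ≤ s} < c := hsub ⟨hs.1, hs.2.trans_lt hre⟩
    have h2 : μ.real {ω | W ω ≤ t} ≤ μ.real {ω | W ω ≤ s} :=
      measureReal_mono fun ω hω => le_trans hω hs.1
    linarith
  · exact .of_forall fun s => mul_nonneg (hg0 s) (sub_nonneg.2 (hle s))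

lemma measurableSet_le_le_snd {Z : Ω → ℝ × ℝ} (hZ : Measurable Z) :
    MeasurableSet {p : Ω × ℝ × ℝ | (Z p.1).2 ≤ p.2.1 ∧ (Z p.1).1 ≤ p.2.2} :=
  (measurableSet_le (hZ.comp measurable_fst).snd measurable_snd.fst).inter
    (measurableSet_le (hZ.comp measurable_fst).fst measurable_snd.snd)

/-- Two-dimensional integration by parts: `u` splits into its two boundary sections at `b` and the
mixed partial derivative `w` integrated over an upper-right quadrant. -/
lemma eq_add_sub_add_integral_mixed {u u₂ w : ℝ × ℝ → ℝ}
    (hu : ∀ s t, HasDerivAt (fun y => u (s, y)) (u₂ (s, t)) t)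
    (hu₂ : ∀ s t, HasDerivAt (fun x => u₂ (x, t)) (w (s, t)) s)
    (hu₂c : Continuous u₂) (hw : Continuous w) {b x y : ℝ} (hx : x ≤ b) (hy : y ≤ b) :
    u (x, y) = u (x, b) + u (b, y) - u (b, b)
      + ∫ p in Icc y b ×ˢ Icc x b, w (p.2, p.1) := by
  have hint : IntegrableOn (fun p : ℝ × ℝ => w (p.2, p.1)) (Icc y b ×ˢ Icc x b) :=
    (hw.comp continuous_swap).continuousOn.integrableOn_compact (isCompact_Icc.prod isCompact_Icc)
  have hsec : ∀ s, Continuous fun t => u₂ (s, t) := fun s => by fun_prop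
  have hI : ∀ s, ∫ t in y..b, u₂ (s, t) = u (s, b) - u (s, y) := fun s =>
    intervalIntegral.integral_eq_sub_of_hasDerivAt (fun t _ => hu s t)
      ((hsec s).intervalIntegrable _ _)
  rw [Measure.volume_eq_prod] at hint ⊢
  rw [setIntegral_prod _ hint]
  have hinner : ∀ t, ∫ s in Icc x b, w (s, t) = u₂ (b, t) - u₂ (x, t) := fun t => by
    rw [integral_Icc_eq_integral_Ioc, ← intervalIntegral.integral_of_le hx]
    refine intervalIntegral.integral_eq_sub_of_hasDerivAt (fun s _ => hu₂ s t)
      (Continuous.intervalIntegrable ?_ _ _)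
    fun_prop
  simp only [hinner]
  rw [integral_Icc_eq_integral_Ioc, ← intervalIntegral.integral_of_le hy,
    intervalIntegral.integral_sub ((hsec b).intervalIntegrable _ _)
      ((hsec x).intervalIntegrable _ _), hI, hI]
  ring

lemma integrable_comp_of_mem_compact {F : Type*} [TopologicalSpace F] [MeasurableSpace F]
    [BorelSpace F] (μ : Measure Ω) [IsFiniteMeasure μ] {Z : Ω → F} (hZ : Measurable Z) {K : Set F}
    (hK : IsCompact K) (hZK : ∀ᵐ ω ∂μ, Z ω ∈ K) {g : F → ℝ} (hg : Continuous g) :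
    Integrable (fun ω => g (Z ω)) μ := by
  obtain ⟨C, hC⟩ := hK.exists_bound_of_continuousOn hg.continuousOn
  exact Integrable.of_bound (hg.measurable.comp hZ).aestronglyMeasurable C
    (hZK.mono fun ω hω => hC _ hω)

lemma integral_comp_eq_add_integral_mixed (μ : Measure Ω) [IsProbabilityMeasure μ]
    {Z : Ω → ℝ × ℝ} (hZ : Measurable Z) {a b : ℝ}
    (hZab : ∀ᵐ ω ∂μ, Z ω ∈ Icc a b ×ˢ Icc a b) {u u₂ w : ℝ × ℝ → ℝ} (huc : Continuous u)
    (hu : ∀ s t, HasDerivAt (fun y => u (s, y)) (u₂ (s, t)) t)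
    (hu₂ : ∀ s t, HasDerivAt (fun x => u₂ (x, t)) (w (s, t)) s)
    (hu₂c : Continuous u₂) (hw : Continuous w) :
    ∫ ω, u (Z ω) ∂μ = ∫ ω, u ((Z ω).1, b) ∂μ + ∫ ω, u (b, (Z ω).2) ∂μ - u (b, b)
      + ∫ p in Icc a b ×ˢ Icc a b,
        w (p.2, p.1) * μ.real {ω | (Z ω).2 ≤ p.1 ∧ (Z ω).1 ≤ p.2} := by
  have hKc : IsCompact (Icc a b ×ˢ Icc a b) := isCompact_Icc.prod isCompact_Icc
  have hk : Integrable (fun p : ℝ × ℝ => w (p.2, p.1))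
      (volume.restrict (Icc a b ×ˢ Icc a b)) :=
    (hw.comp continuous_swap).continuousOn.integrableOn_compact hKc
  have hA := measurableSet_le_le_snd hZ
  have hmixed := integral_integral_indicator_snd μ _ hk hA
  have i3 := (integrable_indicator_snd μ _ hk hA).integral_prod_left
  have i1 : Integrable (fun ω => u ((Z ω).1, b)) μ :=
    integrable_comp_of_mem_compact μ hZ hKc hZab (g := fun z => u (z.1, b)) (by fun_prop)
  have i2 : Integrable (fun ω => u (b, (Z ω).2)) μ :=
    integrable_comp_of_mem_compact μ hZ hKc hZab (g := fun z => u (b, z.2)) (by fun_prop)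
  simp only [mem_ofPred_eq] at hmixed
  rw [← hmixed]
  have : ∫ ω, u (Z ω) ∂μ = ∫ ω, (u ((Z ω).1, b) + u (b, (Z ω).2) - u (b, b)
      + ∫ p in Icc a b ×ˢ Icc a b,
        {p : Ω × ℝ × ℝ | (Z p.1).2 ≤ p.2.1 ∧ (Z p.1).1 ≤ p.2.2}.indicator
          (fun p => w (p.2.2, p.2.1)) (ω, p)) ∂μ := by
    refine integral_congr_ae ?_
    filter_upwards [hZab] with ω hω
    have h1 : (fun p : ℝ × ℝ => {p : Ω × ℝ × ℝ | (Z p.1).2 ≤ p.2.1 ∧ (Z p.1).1 ≤ p.2.2}.indicator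
          (fun p => w (p.2.2, p.2.1)) (ω, p))
        = (Ici (Z ω).2 ×ˢ Ici (Z ω).1).indicator fun p => w (p.2, p.1) := by
      ext p; simp [indicator, ← Prod.mk_le_mk]
    have h2 : Icc a b ×ˢ Icc a b ∩ Ici (Z ω).2 ×ˢ Ici (Z ω).1
        = Icc (Z ω).2 b ×ˢ Icc (Z ω).1 b := by
      ext p
      simp only [mem_prod, mem_Icc] at hω
      simp only [mem_inter_iff, mem_prod, mem_Icc, mem_Ici]
      grind
    rw [h1, setIntegral_indicator (measurableSet_Ici.prod measurableSet_Ici), h2]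
    exact eq_add_sub_add_integral_mixed hu hu₂ hu₂c hw hω.1.2 hω.2.2
  have i12 : Integrable (fun ω => u ((Z ω).1, b) + u (b, (Z ω).2)) μ := i1.add i2
  have i12' : Integrable (fun ω => u ((Z ω).1, b) + u (b, (Z ω).2) - u (b, b)) μ :=
    i12.sub (integrable_const _)
  rw [this, integral_add i12' i3, integral_sub i12 (integrable_const _), integral_add i1 i2]
  simp

lemma integral_mixed_le (μ : Measure Ω) [IsProbabilityMeasure μ]
    {Z W : Ω → ℝ × ℝ} (hZ : Measurable Z) (hW : Measurable W) {a b : ℝ} {w : ℝ × ℝ → ℝ}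
    (hw : Continuous w) (hw0 : ∀ p, w p ≤ 0)
    (hle : ∀ s t, μ.real {ω | (Z ω).1 ≤ s ∧ (Z ω).2 ≤ t}
      ≤ μ.real {ω | (W ω).1 ≤ s ∧ (W ω).2 ≤ t}) :
    ∫ p in Icc a b ×ˢ Icc a b, w (p.2, p.1) * μ.real {ω | (W ω).2 ≤ p.1 ∧ (W ω).1 ≤ p.2}
      ≤ ∫ p in Icc a b ×ˢ Icc a b,
        w (p.2, p.1) * μ.real {ω | (Z ω).2 ≤ p.1 ∧ (Z ω).1 ≤ p.2} := by
  have hk : Integrable (fun p : ℝ × ℝ => w (p.2, p.1))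
      (volume.restrict (Icc a b ×ˢ Icc a b)) :=
    (hw.comp continuous_swap).continuousOn.integrableOn_compact
      (isCompact_Icc.prod isCompact_Icc)
  refine integral_mono (integrable_mul_measureReal μ _ hk (measurableSet_le_le_snd hW))
    (integrable_mul_measureReal μ _ hk (measurableSet_le_le_snd hZ)) fun p => ?_
  refine mul_le_mul_of_nonpos_left ?_ (hw0 _)
  simpa only [and_comm] using hle p.2 p.1

lemma exists_ae_mem_Icc_prod (μ : Measure Ω) {Z : Ω → ℝ × ℝ} (hZ : Measurable Z)
    (hZc : ∃ K : Set (ℝ × ℝ), IsCompact K ∧ Measure.map Z μ Kᶜ = 0) :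
    ∃ R : ℝ, ∀ R' ≥ R, ∀ᵐ ω ∂μ, Z ω ∈ Icc (-R') R' ×ˢ Icc (-R') R' := by
  obtain ⟨K, hK, h0⟩ := hZc
  obtain ⟨R, hR⟩ := hK.isBounded.exists_norm_le
  refine ⟨R, fun R' hR' => ?_⟩
  have h1 : ∀ᵐ z ∂(Measure.map Z μ), z ∈ K := h0
  filter_upwards [ae_of_ae_map hZ.aemeasurable h1] with ω hω
  have h2 := (hR _ hω).trans hR'
  rw [Prod.norm_def, max_le_iff, Real.norm_eq_abs, Real.norm_eq_abs, abs_le, abs_le] at h2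
  exact h2

end Expectation

lemma hasDerivAt_mk_left {f : ℝ × ℝ → ℝ} (hf : Differentiable ℝ f) (s t : ℝ) :
    HasDerivAt (fun x => f (x, t)) (fderiv ℝ f (s, t) (1, 0)) s :=
  (hf (s, t)).hasFDerivAt.comp_hasDerivAt s ((hasDerivAt_id s).prodMk (hasDerivAt_const s t))

lemma hasDerivAt_mk_right {f : ℝ × ℝ → ℝ} (hf : Differentiable ℝ f) (s t : ℝ) :
    HasDerivAt (fun y => f (s, y)) (fderiv ℝ f (s, t) (0, 1)) t :=
  (hf (s, t)).hasFDerivAt.comp_hasDerivAt t ((hasDerivAt_const t s).prodMk (hasDerivAt_id t))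

/-- If `X` distributionally dominates `Y` (both with compactly supported laws), then every
strictly monotonically increasing, twice continuously differentiable utility with
nonpositive mixed partial derivative has strictly greater expectation under `X`. -/
theorem stmt1 {Ω : Type*} [MeasureSpace Ω] [IsProbabilityMeasure (ℙ : Measure Ω)]
    (X Y : Ω → ℝ × ℝ) (hX : Measurable X) (hY : Measurable Y)
    (hXc : ∃ K : Set (ℝ × ℝ), IsCompact K ∧ Measure.map X ℙ Kᶜ = 0)
    (hYc : ∃ K : Set (ℝ × ℝ), IsCompact K ∧ Measure.map Y ℙ Kᶜ = 0)
    (hdom : DistDom2 X Y) :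
    ∀ u : ℝ × ℝ → ℝ, ContDiff ℝ 2 u → StrictlyMonoIncr2 u →
      (∀ a b : ℝ, deriv (fun x₁ => deriv (fun x₂ => u (x₁, x₂)) b) a ≤ 0) →
      ∫ ω, u (Y ω) ∂ℙ < ∫ ω, u (X ω) ∂ℙ := by
  intro u hu hmono hmix
  obtain ⟨R₁, hR₁⟩ := exists_ae_mem_Icc_prod ℙ hX hXc
  obtain ⟨R₂, hR₂⟩ := exists_ae_mem_Icc_prod ℙ hY hYc
  obtain ⟨R, hXR, hYR⟩ : ∃ R : ℝ, (∀ᵐ ω, X ω ∈ Icc (-R) R ×ˢ Icc (-R) R) ∧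
      ∀ᵐ ω, Y ω ∈ Icc (-R) R ×ˢ Icc (-R) R :=
    ⟨max R₁ R₂, hR₁ _ (le_max_left _ _), hR₂ _ (le_max_right _ _)⟩
  have hdu : Differentiable ℝ u := hu.differentiable (by norm_num)
  have hfd : ContDiff ℝ 1 (fderiv ℝ u) := hu.fderiv_right (by norm_num)
  have hu₂C : ContDiff ℝ 1 fun p => fderiv ℝ u p (0, 1) := hfd.clm_apply contDiff_const
  have hdu₂ := hu₂C.differentiable (by norm_num)
  have hw : Continuous fun p => fderiv ℝ (fun p => fderiv ℝ u p (0, 1)) p (1, 0) :=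
    (hu₂C.continuous_fderiv (by norm_num)).clm_apply continuous_const
  have hw0 : ∀ p, fderiv ℝ (fun p => fderiv ℝ u p (0, 1)) p (1, 0) ≤ 0 := by
    rintro ⟨s, t⟩
    have h := hmix s t
    simp only [fun x => (hasDerivAt_mk_right hdu x t).deriv] at h
    rwa [(hasDerivAt_mk_left hdu₂ s t).deriv] at h
  have hjoint : ∀ s t, (ℙ : Measure Ω).real {ω | (X ω).1 ≤ s ∧ (X ω).2 ≤ t}
      ≤ (ℙ : Measure Ω).real {ω | (Y ω).1 ≤ s ∧ (Y ω).2 ≤ t} := fun s t => hdom.1 (s, t)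
  have hfst : ∀ Z : Ω → ℝ × ℝ, (∀ᵐ ω, Z ω ∈ Icc (-R) R ×ˢ Icc (-R) R) → ∀ s,
      (ℙ : Measure Ω).real {ω | (Z ω).1 ≤ s ∧ (Z ω).2 ≤ R}
        = (ℙ : Measure Ω).real {ω | (Z ω).1 ≤ s} := fun Z hZ s =>
    measureReal_congr (hZ.mono fun ω hω => propext (and_iff_left hω.2.2))
  have hsnd : ∀ Z : Ω → ℝ × ℝ, (∀ᵐ ω, Z ω ∈ Icc (-R) R ×ˢ Icc (-R) R) → ∀ t,
      (ℙ : Measure Ω).real {ω | (Z ω).1 ≤ R ∧ (Z ω).2 ≤ t}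
        = (ℙ : Measure Ω).real {ω | (Z ω).2 ≤ t} := fun Z hZ t =>
    measureReal_congr (hZ.mono fun ω hω => propext (and_iff_right hω.1.2))
  have hle₁ := fun s => (hfst X hXR s).symm.trans_le ((hjoint s R).trans_eq (hfst Y hYR s))
  have hle₂ := fun t => (hsnd X hXR t).symm.trans_le ((hjoint R t).trans_eq (hsnd Y hYR t))
  have hmono₁ : StrictMono fun x => u (x, R) := fun x y hxy =>
    hmono _ _ ⟨⟨hxy.le, le_rfl⟩, .inl hxy⟩
  have hmono₂ : StrictMono fun y => u (R, y) := fun x y hxy =>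
    hmono _ _ ⟨⟨le_rfl, hxy.le⟩, .inr hxy⟩
  have hg₁ := fun s => hasDerivAt_mk_left hdu s R
  have hg₂ := fun t => hasDerivAt_mk_right hdu R t
  have hc₁ : Continuous fun s => fderiv ℝ u (s, R) (1, 0) :=
    (hfd.continuous.comp (by fun_prop)).clm_apply continuous_const
  have hc₂ : Continuous fun t => fderiv ℝ u (R, t) (0, 1) :=
    (hfd.continuous.comp (by fun_prop)).clm_apply continuous_const
  have hX₁ := hXR.mono fun ω hω => hω.1
  have hX₂ := hXR.mono fun ω hω => hω.2
  have hY₁ := hYR.mono fun ω hω => hω.1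
  have hY₂ := hYR.mono fun ω hω => hω.2
  have le₁ := integral_comp_le_of_cdf_le ℙ hX.fst hY.fst hX₁ hY₁ hg₁ hc₁ hmono₁ hle₁
  have le₂ := integral_comp_le_of_cdf_le ℙ hX.snd hY.snd hX₂ hY₂ hg₂ hc₂ hmono₂ hle₂
  have le₃ := integral_mixed_le (a := -R) (b := R) ℙ hX hY hw hw0 hjoint
  rw [integral_comp_eq_add_integral_mixed ℙ hX hXR hu.continuous (hasDerivAt_mk_right hdu)
      (hasDerivAt_mk_left hdu₂) hu₂C.continuous hw,
    integral_comp_eq_add_integral_mixed ℙ hY hYR hu.continuous (hasDerivAt_mk_right hdu)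
      (hasDerivAt_mk_left hdu₂) hu₂C.continuous hw]
  rcases hdom.2 with h | h
  · have lt₁ := integral_comp_lt_of_cdf_lt ℙ hX.fst hY.fst hX₁ hY₁ hg₁ hc₁ hmono₁ hle₁ h.2
    linarith
  · have lt₂ := integral_comp_lt_of_cdf_lt ℙ hX.snd hY.snd hX₂ hY₂ hg₂ hc₂ hmono₂ hle₂ h.2
    linarith
end

section
/- Let (Z^π)_{π ∈ Π} be a family of integrable random vectors taking values in ℝ^d indexed by a set Π. If π ∈ Π is such that no π' ∈ Π satisfies E[Z^{π'}] Pareto dominates E[Z^π] (i.e., π belongs to the Pareto front), then no π' ∈ Π satisfies Z^{π'} distributionally dominates Z^π (i.e., π belongs to the distributional undominated set). Hence the Pareto front is a subset of the distributional undominated set. -/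
open MeasureTheory
open scoped ProbabilityTheory

open Set Filter Topology

/-- The joint CDF tends to the marginal CDF as all other thresholds tend to infinity. -/
lemma tendsto_jointCDF_update {Ω : Type*} [MeasureSpace Ω] [IsProbabilityMeasure (ℙ : Measure Ω)]
    {d : ℕ} (X : Ω → Fin d → ℝ) (i : Fin d) (t : ℝ) :
    Tendsto (fun n : ℕ => jointCDF X (Function.update (fun _ => (n : ℝ)) i t)) atTop
      (𝓝 (margCDF X i t)) := by
  have hmono : Monotone fun n : ℕ =>
      {ω | ∀ j, X ω j ≤ Function.update (fun _ => (n : ℝ)) i t j} := by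
    intro m n hmn ω hω j
    refine (hω j).trans ?_
    have hmn' : (m : ℝ) ≤ n := by exact_mod_cast hmn
    by_cases hj : j = i
    · subst hj; simp
    · simpa [hj] using hmn'
  have hUnion : ⋃ n : ℕ, {ω | ∀ j, X ω j ≤ Function.update (fun _ => (n : ℝ)) i t j} =
      {ω | X ω i ≤ t} := by
    ext ω
    simp only [mem_iUnion, mem_ofPred_eq]
    constructor
    · rintro ⟨n, hn⟩
      simpa using hn i
    · intro h
      obtain ⟨B, hB⟩ := (Set.finite_range (X ω)).bddAbove
      obtain ⟨n, hn⟩ := exists_nat_ge B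
      refine ⟨n, fun j => ?_⟩
      by_cases hj : j = i
      · subst hj; simpa using h
      · simpa [hj] using (hB (mem_range_self j)).trans hn
  have hlim := tendsto_measure_iUnion_atTop (μ := (ℙ : Measure Ω)) hmono
  rw [hUnion] at hlim
  exact (ENNReal.tendsto_toReal (measure_ne_top _ _)).comp hlim

/-- Joint stochastic dominance implies stochastic dominance of every marginal. -/
lemma FSD.margCDF_le {Ω : Type*} [MeasureSpace Ω] [IsProbabilityMeasure (ℙ : Measure Ω)]
    {d : ℕ} {X Y : Ω → Fin d → ℝ} (h : FSD X Y) (i : Fin d) (t : ℝ) :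
    margCDF X i t ≤ margCDF Y i t :=
  le_of_tendsto_of_tendsto' (tendsto_jointCDF_update X i t) (tendsto_jointCDF_update Y i t)
    fun _ => h _

section Univariate

variable {Ω : Type*} [MeasurableSpace Ω] {μ : Measure Ω}

lemma lintegral_ofReal_eq_lintegral_meas_lt {f : Ω → ℝ} (hf : AEMeasurable f μ) :
    ∫⁻ ω, ENNReal.ofReal (f ω) ∂μ = ∫⁻ t in Ioi 0, μ {ω | t < f ω} := by
  have h := lintegral_eq_lintegral_meas_lt μ (f := fun ω => max (f ω) 0)
    (Eventually.of_forall fun _ => le_max_right _ _) (hf.max aemeasurable_const)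
  simp only [ENNReal.ofReal_max, ENNReal.ofReal_zero, max_zero] at h
  rw [h]
  refine setLIntegral_congr_fun measurableSet_Ioi fun t (ht : 0 < t) => ?_
  simp [ht.not_gt]

lemma lintegral_ofReal_eq_lintegral_meas_le {f : Ω → ℝ} (hf : AEMeasurable f μ) :
    ∫⁻ ω, ENNReal.ofReal (f ω) ∂μ = ∫⁻ t in Ioi 0, μ {ω | t ≤ f ω} := by
  have h := lintegral_eq_lintegral_meas_le μ (f := fun ω => max (f ω) 0)
    (Eventually.of_forall fun _ => le_max_right _ _) (hf.max aemeasurable_const)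
  simp only [ENNReal.ofReal_max, ENNReal.ofReal_zero, max_zero] at h
  rw [h]
  refine setLIntegral_congr_fun measurableSet_Ioi fun t (ht : 0 < t) => ?_
  simp [ht.not_ge]

variable {f g : Ω → ℝ}

lemma lintegral_ofReal_neg_le_of_cdf_le (hf : Measurable f) (hg : Measurable g)
    (h : ∀ t, μ {ω | f ω ≤ t} ≤ μ {ω | g ω ≤ t}) :
    ∫⁻ ω, ENNReal.ofReal (-f ω) ∂μ ≤ ∫⁻ ω, ENNReal.ofReal (-g ω) ∂μ := by
  rw [lintegral_ofReal_eq_lintegral_meas_le (f := fun ω => -f ω) hf.neg.aemeasurable,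
    lintegral_ofReal_eq_lintegral_meas_le (f := fun ω => -g ω) hg.neg.aemeasurable]
  refine lintegral_mono fun t => ?_
  simpa only [le_neg] using h (-t)

variable [IsProbabilityMeasure μ]

lemma meas_gt_eq_one_sub (hf : Measurable f) (t : ℝ) :
    μ {ω | t < f ω} = 1 - μ {ω | f ω ≤ t} := by
  rw [← prob_compl_eq_one_sub (measurableSet_le hf measurable_const)]
  congr 1
  ext ω
  simp

lemma lintegral_ofReal_le_of_cdf_le (hf : Measurable f) (hg : Measurable g)
    (h : ∀ t, μ {ω | f ω ≤ t} ≤ μ {ω | g ω ≤ t}) :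
    ∫⁻ ω, ENNReal.ofReal (g ω) ∂μ ≤ ∫⁻ ω, ENNReal.ofReal (f ω) ∂μ := by
  rw [lintegral_ofReal_eq_lintegral_meas_lt hf.aemeasurable,
    lintegral_ofReal_eq_lintegral_meas_lt hg.aemeasurable]
  refine lintegral_mono fun t => ?_
  simp only [meas_gt_eq_one_sub hf, meas_gt_eq_one_sub hg]
  exact tsub_le_tsub_left (h t) 1

/-- First-order stochastic dominance implies the inequality of expectations. -/
lemma integral_le_of_cdf_le (hf : Measurable f) (hg : Measurable g)
    (hfi : Integrable f μ) (hgi : Integrable g μ)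
    (h : ∀ t, μ {ω | f ω ≤ t} ≤ μ {ω | g ω ≤ t}) :
    ∫ ω, g ω ∂μ ≤ ∫ ω, f ω ∂μ := by
  rw [integral_eq_lintegral_pos_part_sub_lintegral_neg_part hfi,
    integral_eq_lintegral_pos_part_sub_lintegral_neg_part hgi]
  exact sub_le_sub
    (ENNReal.toReal_mono hfi.lintegral_lt_top.ne (lintegral_ofReal_le_of_cdf_le hf hg h))
    (ENNReal.toReal_mono hgi.neg.lintegral_lt_top.ne (lintegral_ofReal_neg_le_of_cdf_le hf hg h))

lemma exists_forall_cdf_lt (hf : Measurable f) {t : ℝ} {c : ENNReal}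
    (h : μ {ω | f ω ≤ t} < c) : ∃ u > t, μ {ω | f ω ≤ u} < c := by
  have hInter : ⋂ u > t, {ω | f ω ≤ u} = {ω | f ω ≤ t} := by
    ext ω
    simp only [mem_iInter, mem_ofPred_eq]
    exact ⟨le_of_forall_gt_imp_ge_of_dense, fun hω u hu => hω.trans hu.le⟩
  have hlim := tendsto_measure_biInter_gt (μ := μ) (s := fun u => {ω | f ω ≤ u}) (a := t)
    (fun u _ => (measurableSet_le hf measurable_const).nullMeasurableSet)
    (fun u v _ huv ω hω => le_trans hω huv) ⟨t + 1, by simp, measure_ne_top _ _⟩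
  rw [hInter] at hlim
  obtain ⟨u, hu, hut⟩ := ((hlim.eventually (gt_mem_nhds h)).and self_mem_nhdsWithin).exists
  exact ⟨u, hut, hu⟩

/-- Strict first-order stochastic dominance implies the strict inequality of expectations. -/
lemma integral_lt_of_cdf_le_of_cdf_lt (hf : Measurable f) (hg : Measurable g)
    (hfi : Integrable f μ) (hgi : Integrable g μ)
    (h : ∀ t, μ {ω | f ω ≤ t} ≤ μ {ω | g ω ≤ t})
    {t : ℝ} (ht : μ {ω | f ω ≤ t} < μ {ω | g ω ≤ t}) :
    ∫ ω, g ω ∂μ < ∫ ω, f ω ∂μ := by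
  wlog ht0 : t = 0 generalizing f g t
  · have key := this (f := fun ω => f ω - t) (g := fun ω => g ω - t) (t := 0)
      (hf.sub_const t) (hg.sub_const t) (hfi.sub (integrable_const t))
      (hgi.sub (integrable_const t))
      (fun s => by simpa only [sub_le_iff_le_add] using h (s + t))
      (by simpa only [sub_le_iff_le_add, zero_add] using ht) rfl
    rw [integral_sub hfi (integrable_const t), integral_sub hgi (integrable_const t)] at key
    linarith
  subst ht0
  obtain ⟨u, hu, hlt⟩ := exists_forall_cdf_lt hf ht
  have hpos : ∫⁻ ω, ENNReal.ofReal (g ω) ∂μ < ∫⁻ ω, ENNReal.ofReal (f ω) ∂μ := by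
    have hfin := hgi.lintegral_lt_top.ne
    rw [lintegral_ofReal_eq_lintegral_meas_lt hg.aemeasurable] at hfin
    rw [lintegral_ofReal_eq_lintegral_meas_lt hf.aemeasurable,
      lintegral_ofReal_eq_lintegral_meas_lt hg.aemeasurable]
    have hmeas : Measurable fun s => μ {ω | s < f ω} :=
      Antitone.measurable fun a b hab => measure_mono fun ω hω => lt_of_le_of_lt hab hω
    refine lintegral_strict_mono_of_ae_le_of_ae_lt_on hmeas.aemeasurable hfin
      (Eventually.of_forall fun s => ?_) (s := Ioo 0 u) ?_ (Eventually.of_forall fun s hs => ?_)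
    · simp only [meas_gt_eq_one_sub hf, meas_gt_eq_one_sub hg]
      exact tsub_le_tsub_left (h s) 1
    · rw [Measure.restrict_apply measurableSet_Ioo,
        inter_eq_left.mpr Ioo_subset_Ioi_self]
      simpa using hu
    · simp only [meas_gt_eq_one_sub hf, meas_gt_eq_one_sub hg]
      have hfs : μ {ω | f ω ≤ s} < μ {ω | g ω ≤ s} :=
        ((measure_mono fun ω hω => le_trans hω hs.2.le).trans_lt hlt).trans_le
          (measure_mono fun ω hω => le_trans hω hs.1.le)
      refine ENNReal.sub_lt_of_sub_lt prob_le_one (.inl ENNReal.one_ne_top) ?_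
      rwa [ENNReal.sub_sub_cancel ENNReal.one_ne_top prob_le_one]
  rw [integral_eq_lintegral_pos_part_sub_lintegral_neg_part hfi,
    integral_eq_lintegral_pos_part_sub_lintegral_neg_part hgi]
  have hpos' := (ENNReal.toReal_lt_toReal hgi.lintegral_lt_top.ne hfi.lintegral_lt_top.ne).mpr hpos
  have hneg := ENNReal.toReal_mono hgi.neg.lintegral_lt_top.ne
    (lintegral_ofReal_neg_le_of_cdf_le hf hg h)
  simp only [Pi.neg_apply] at hneg
  linarith

end Univariate

/-- If a policy's expected return is not Pareto dominated by any other policy's expected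
return, then its return distribution is not distributionally dominated by any other policy's
return distribution: the Pareto front is a subset of the distributional undominated set. -/
theorem stmt3 {Ω : Type*} [MeasureSpace Ω] [IsProbabilityMeasure (ℙ : Measure Ω)]
    {d : ℕ} {P : Type*} (Z : P → Ω → Fin d → ℝ)
    (hZm : ∀ p, Measurable (Z p)) (hZi : ∀ p, Integrable (Z p) ℙ)
    (p : P)
    (hpf : ¬ ∃ p' : P, ParetoDom (fun i => ∫ ω, Z p' ω i ∂ℙ) (fun i => ∫ ω, Z p ω i ∂ℙ)) :
    ¬ ∃ p' : P, DistDom (Z p') (Z p) := by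
  rintro ⟨p', hFSD, i, -, t, ht⟩
  have hm (q : P) (j : Fin d) : Measurable fun ω => Z q ω j := (measurable_pi_apply j).comp (hZm q)
  have hi (q : P) (j : Fin d) : Integrable (fun ω => Z q ω j) ℙ := (hZi q).eval j
  have hle (j : Fin d) (s : ℝ) : ℙ {ω | Z p' ω j ≤ s} ≤ ℙ {ω | Z p ω j ≤ s} :=
    (ENNReal.toReal_le_toReal (measure_ne_top _ _) (measure_ne_top _ _)).mp
      (hFSD.margCDF_le j s)
  exact hpf ⟨p', fun j => integral_le_of_cdf_le (hm p' j) (hm p j) (hi p' j) (hi p j) (hle j),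
    i, integral_lt_of_cdf_le_of_cdf_lt (hm p' i) (hm p i) (hi p' i) (hi p i) (hle i)
      ((ENNReal.toReal_lt_toReal (measure_ne_top _ _) (measure_ne_top _ _)).mp ht)⟩
end

section
/- Let X₁,…,X_n and Y₁,…,Y_n be random vectors taking values in ℝ² with compactly supported laws. Suppose there exists λ in the standard simplex Δⁿ (λ_i ≥ 0, Σ λ_i = 1) such that the mixture probability measure Σ_{i=1}^n λ_i · Law(X_i) distributionally dominates the mixture Σ_{i=1}^n λ_i · Law(Y_i). Then for every strictly monotonically increasing, twice continuously differentiable function u : ℝ² → ℝ with ∂²u/∂x₁∂x₂ ≤ 0 everywhere, there exists i ∈ {1,…,n} with E[u(X_i)] > E[u(Y_i)]. -/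
open MeasureTheory
open scoped ProbabilityTheory ENNReal

/-- Joint CDF of a measure on `ℝ²`. -/
noncomputable def mJointCDF2 (μ : Measure (ℝ × ℝ)) (v : ℝ × ℝ) : ℝ :=
  (μ {x | x.1 ≤ v.1 ∧ x.2 ≤ v.2}).toReal

/-- Marginal CDF of the first coordinate of a measure on `ℝ²`. -/
noncomputable def mMargFst (μ : Measure (ℝ × ℝ)) (t : ℝ) : ℝ :=
  (μ {x | x.1 ≤ t}).toReal

/-- Marginal CDF of the second coordinate of a measure on `ℝ²`. -/
noncomputable def mMargSnd (μ : Measure (ℝ × ℝ)) (t : ℝ) : ℝ :=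
  (μ {x | x.2 ≤ t}).toReal

/-- The mean vector of a measure on `ℝ²`. -/
noncomputable def mMean (μ : Measure (ℝ × ℝ)) : ℝ × ℝ :=
  (∫ x, x.1 ∂μ, ∫ x, x.2 ∂μ)

/-- `μ` first-order stochastically dominates `ν`. -/
def mFSD2 (μ ν : Measure (ℝ × ℝ)) : Prop :=
  ∀ v : ℝ × ℝ, mJointCDF2 μ v ≤ mJointCDF2 ν v

/-- `μ` distributionally dominates `ν`: joint FSD together with strict FSD of some
marginal. -/
def mDistDom2 (μ ν : Measure (ℝ × ℝ)) : Prop :=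
  mFSD2 μ ν ∧
    (StrictFSDcdf (mMargFst μ) (mMargFst ν) ∨ StrictFSDcdf (mMargSnd μ) (mMargSnd ν))

open Set in
theorem integrable_and_integral_setIntegral_Icc {β : Type*} [TopologicalSpace β] [PartialOrder β]
    [OrderClosedTopology β] [SecondCountableTopology β] [MeasurableSpace β] [BorelSpace β]
    {μ τ : Measure β} [IsFiniteMeasure μ] [SFinite τ] {a b : β} {h : β → ℝ}
    (hh : IntegrableOn h (Icc a b) τ) (hμ : ∀ᵐ x ∂μ, x ∈ Icc a b) :
    Integrable (fun x => ∫ s in Icc x b, h s ∂τ) μ ∧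
      ∫ x, ∫ s in Icc x b, h s ∂τ ∂μ = ∫ s in Icc a b, h s * μ.real (Iic s) ∂τ := by
  have hS : MeasurableSet {p : β × β | p.1 ≤ p.2} := measurableSet_le measurable_fst measurable_snd
  have hint : Integrable
      (Function.uncurry fun x s => {p : β × β | p.1 ≤ p.2}.indicator (fun p => h p.2) (x, s))
      (μ.prod (τ.restrict (Icc a b))) := (hh.comp_snd μ).indicator hS
  have hae : (fun x => ∫ s in Icc a b,
      {p : β × β | p.1 ≤ p.2}.indicator (fun p => h p.2) (x, s) ∂τ) =ᵐ[μ]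
      fun x => ∫ s in Icc x b, h s ∂τ := by
    filter_upwards [hμ] with x hx
    change ∫ s in Icc a b, (Ici x).indicator h s ∂τ = _
    rw [setIntegral_indicator measurableSet_Ici]
    congr 2
    ext s
    simp only [mem_inter_iff, mem_Icc, mem_Ici]
    exact ⟨fun H => ⟨H.2, H.1.2⟩, fun H => ⟨⟨hx.1.trans H.1, H.2⟩, H.1⟩⟩
  refine ⟨hint.integral_prod_left.congr hae, ?_⟩
  rw [← integral_congr_ae hae, integral_integral_swap hint]
  congr 1
  ext s
  change ∫ x, (Iic s).indicator (fun _ => h s) x ∂μ = _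
  rw [integral_indicator_const _ measurableSet_Iic, smul_eq_mul, mul_comm]

theorem setIntegral_Icc_deriv {f : ℝ → ℝ} (hf : ContDiff ℝ 1 f) {x b : ℝ} (hx : x ≤ b) :
    ∫ s in Set.Icc x b, deriv f s = f b - f x := by
  rw [integral_Icc_eq_integral_Ioc, ← intervalIntegral.integral_of_le hx]
  exact intervalIntegral.integral_deriv_eq_sub'
    f rfl (fun y _ => (hf.differentiable one_ne_zero) y)
    (hf.continuous_deriv le_rfl).continuousOn

open Set in
theorem integrableOn_mul_cdf {β : Type*} [TopologicalSpace β] [PartialOrder β]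
    [OrderClosedTopology β] [SecondCountableTopology β] [MeasurableSpace β] [BorelSpace β]
    {μ τ : Measure β} [IsFiniteMeasure μ] [SFinite τ] {a b : β} {h : β → ℝ}
    (hh : IntegrableOn h (Icc a b) τ) :
    IntegrableOn (fun s => h s * μ.real (Iic s)) (Icc a b) τ := by
  have hS : MeasurableSet {p : β × β | p.2 ≤ p.1} := measurableSet_le measurable_snd measurable_fst
  refine Integrable.mul_bdd (c := μ.real univ) hh ?_ ?_
  · exact (measurable_measure_prodMk_left hS).ennreal_toReal.aestronglyMeasurable
  · refine Filter.Eventually.of_forall fun s => ?_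
    rw [Real.norm_of_nonneg measureReal_nonneg]
    exact measureReal_mono (subset_univ _)

open Set in
theorem setIntegral_mul_cdf_mono {β : Type*} [TopologicalSpace β] [PartialOrder β]
    [OrderClosedTopology β] [SecondCountableTopology β] [MeasurableSpace β] [BorelSpace β]
    {μ ν τ : Measure β} [IsFiniteMeasure μ] [IsFiniteMeasure ν] [SFinite τ] {a b : β} {h : β → ℝ}
    (hh : IntegrableOn h (Icc a b) τ) (h0 : ∀ s, 0 ≤ h s)
    (hle : ∀ s ∈ Icc a b, μ.real (Iic s) ≤ ν.real (Iic s)) :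
    ∫ s in Icc a b, h s * μ.real (Iic s) ∂τ ≤ ∫ s in Icc a b, h s * ν.real (Iic s) ∂τ :=
  setIntegral_mono_on (integrableOn_mul_cdf hh) (integrableOn_mul_cdf hh) measurableSet_Icc
    fun s hs => mul_le_mul_of_nonneg_left (hle s hs) (h0 s)

open Set in
theorem setIntegral_deriv_mul_cdf_lt {p q : Measure ℝ} [IsProbabilityMeasure p]
    [IsProbabilityMeasure q] {a b t : ℝ} {f : ℝ → ℝ} (hf : ContDiff ℝ 1 f) (hmono : StrictMono f)
    (hle : ∀ s, p.real (Iic s) ≤ q.real (Iic s)) (hat : a ≤ t) (htb : t < b)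
    (hlt : p.real (Iic t) < q.real (Iic t)) :
    ∫ s in Icc a b, deriv f s * p.real (Iic s) < ∫ s in Icc a b, deriv f s * q.real (Iic s) := by
  have hd : ∀ s, 0 ≤ deriv f s := fun s => hmono.monotone.deriv_nonneg
  have hi : IntegrableOn (deriv f) (Icc a b) := (hf.continuous_deriv le_rfl).integrableOn_Icc
  have hp := integrableOn_mul_cdf (μ := p) hi
  have hq := integrableOn_mul_cdf (μ := q) hi
  obtain ⟨ε, hε, hεlt⟩ : ∃ ε > 0, ε < q.real (Iic t) - p.real (Iic t) :=
    exists_between (sub_pos.2 hlt)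
  have hcont : ContinuousWithinAt (fun s => q.real (Iic s) - p.real (Iic s)) (Ici t) t := by
    simp only [← ProbabilityTheory.cdf_eq_real]
    exact ((ProbabilityTheory.cdf q).right_continuous t).sub
      ((ProbabilityTheory.cdf p).right_continuous t)
  obtain ⟨c, htc, hc⟩ := mem_nhdsGE_iff_exists_Icc_subset.1 (hcont.eventually_const_lt hεlt)
  set d := min b c with hdef
  have htd : t < d := lt_min htb htc
  have hsub : Icc t d ⊆ Icc a b := Icc_subset_Icc hat (min_le_left _ _)
  have key : ε * (f d - f t) ≤
      ∫ s in Icc a b, (deriv f s * q.real (Iic s) - deriv f s * p.real (Iic s)) := by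
    rw [← setIntegral_Icc_deriv hf htd.le, ← integral_const_mul]
    refine le_trans (setIntegral_mono_on ((hi.mono_set hsub).const_mul ε)
      ((hq.sub hp).mono_set hsub) measurableSet_Icc fun s hs => ?_)
      (setIntegral_mono_set (hq.sub hp) (.of_forall fun s => ?_) hsub.eventuallyLE)
    · have : ε < q.real (Iic s) - p.real (Iic s) := hc ⟨hs.1, hs.2.trans (min_le_right _ _)⟩
      change _ ≤ deriv f s * q.real (Iic s) - deriv f s * p.real (Iic s)
      nlinarith [hd s]
    · change 0 ≤ deriv f s * q.real (Iic s) - deriv f s * p.real (Iic s)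
      nlinarith [hd s, hle s]
  rw [integral_sub hq hp] at key
  have := mul_pos hε (sub_pos.2 (hmono htd))
  linarith

section Utility

variable {u : ℝ × ℝ → ℝ}

theorem deriv_fst_eq_fderiv {f : ℝ × ℝ → ℝ} (hf : Differentiable ℝ f) (s t : ℝ) :
    deriv (fun x => f (x, t)) s = fderiv ℝ f (s, t) (1, 0) :=
  ((hf (s, t)).hasFDerivAt.comp_hasDerivAt s
    ((hasDerivAt_id s).prodMk (hasDerivAt_const s t))).deriv

theorem deriv_snd_eq_fderiv {f : ℝ × ℝ → ℝ} (hf : Differentiable ℝ f) (s t : ℝ) :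
    deriv (fun y => f (s, y)) t = fderiv ℝ f (s, t) (0, 1) :=
  ((hf (s, t)).hasFDerivAt.comp_hasDerivAt t
    ((hasDerivAt_const t s).prodMk (hasDerivAt_id t))).deriv

/-- The mixed second partial derivative of `u`. -/
noncomputable def mixedDeriv (u : ℝ × ℝ → ℝ) (p : ℝ × ℝ) : ℝ :=
  deriv (fun x₁ => deriv (fun x₂ => u (x₁, x₂)) p.2) p.1

theorem contDiff_deriv_snd (hu : ContDiff ℝ 2 u) :
    ContDiff ℝ 1 fun p : ℝ × ℝ => deriv (fun y => u (p.1, y)) p.2 := by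
  simp only [deriv_snd_eq_fderiv (hu.differentiable two_ne_zero)]
  exact (hu.fderiv_right (m := 1) (by norm_num)).clm_apply contDiff_const

theorem continuous_mixedDeriv (hu : ContDiff ℝ 2 u) : Continuous (mixedDeriv u) := by
  have h := contDiff_deriv_snd hu
  have : mixedDeriv u =
      fun p => fderiv ℝ (fun p : ℝ × ℝ => deriv (fun y => u (p.1, y)) p.2) p (1, 0) :=
    funext fun p => deriv_fst_eq_fderiv (h.differentiable one_ne_zero) p.1 p.2
  rw [this]
  exact (h.continuous_fderiv one_ne_zero).clm_apply continuous_const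

open Set in
theorem setIntegral_mixedDeriv (hu : ContDiff ℝ 2 u) {x b : ℝ × ℝ} (hx : x ≤ b) :
    ∫ p in Icc x b, mixedDeriv u p = u b - u (x.1, b.2) - u (b.1, x.2) + u x := by
  have hint : IntegrableOn (mixedDeriv u) (Icc x.1 b.1 ×ˢ Icc x.2 b.2) (volume.prod volume) :=
    (continuous_mixedDeriv hu).continuousOn.integrableOn_compact (isCompact_Icc.prod isCompact_Icc)
  have hslice : ∀ s, ContDiff ℝ 1 fun y => u (s, y) := fun s =>
    (hu.of_le one_le_two).comp (contDiff_const.prodMk contDiff_id)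
  rw [IntegrableOn, ← Measure.prod_restrict] at hint
  rw [← Prod.mk.eta (p := x), ← Prod.mk.eta (p := b), ← Icc_prod_Icc, Measure.volume_eq_prod,
    ← Measure.prod_restrict, integral_prod_symm _ hint]
  have hinner : ∀ t, ∫ s in Icc x.1 b.1, mixedDeriv u (s, t) =
      deriv (fun y => u (b.1, y)) t - deriv (fun y => u (x.1, y)) t := fun t =>
    setIntegral_Icc_deriv (f := fun s => deriv (fun y => u (s, y)) t)
      ((contDiff_deriv_snd hu).comp (contDiff_id.prodMk contDiff_const)) hx.1
  simp only [hinner]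
  rw [integral_sub ((hslice _).continuous_deriv le_rfl).integrableOn_Icc
      ((hslice _).continuous_deriv le_rfl).integrableOn_Icc,
    setIntegral_Icc_deriv (hslice _) hx.2, setIntegral_Icc_deriv (hslice _) hx.2]
  ring

open Set in
theorem integral_eq_of_mem_Icc (hu : ContDiff ℝ 2 u) {μ : Measure (ℝ × ℝ)}
    [IsProbabilityMeasure μ] {a b : ℝ × ℝ} (hμ : ∀ᵐ x ∂μ, x ∈ Icc a b) :
    ∫ x, u x ∂μ = u b
      - (∫ s in Icc a.1 b.1, deriv (fun x => u (x, b.2)) s * (μ.map Prod.fst).real (Iic s))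
      - (∫ t in Icc a.2 b.2, deriv (fun y => u (b.1, y)) t * (μ.map Prod.snd).real (Iic t))
      + ∫ p in Icc a b, mixedDeriv u p * μ.real (Iic p) := by
  have h1 : ContDiff ℝ 1 fun x => u (x, b.2) :=
    (hu.of_le one_le_two).comp (contDiff_id.prodMk contDiff_const)
  have h2 : ContDiff ℝ 1 fun y => u (b.1, y) :=
    (hu.of_le one_le_two).comp (contDiff_const.prodMk contDiff_id)
  have m1 : ∀ᵐ s ∂μ.map Prod.fst, s ∈ Icc a.1 b.1 :=
    (ae_map_iff measurable_fst.aemeasurable measurableSet_Icc).2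
      (hμ.mono fun x hx => ⟨hx.1.1, hx.2.1⟩)
  have m2 : ∀ᵐ s ∂μ.map Prod.snd, s ∈ Icc a.2 b.2 :=
    (ae_map_iff measurable_snd.aemeasurable measurableSet_Icc).2
      (hμ.mono fun x hx => ⟨hx.1.2, hx.2.2⟩)
  have := Measure.isFiniteMeasure_map μ (Prod.fst : ℝ × ℝ → ℝ)
  have := Measure.isFiniteMeasure_map μ (Prod.snd : ℝ × ℝ → ℝ)
  obtain ⟨i1, e1⟩ := integrable_and_integral_setIntegral_Icc (τ := volume)
    (h1.continuous_deriv le_rfl).integrableOn_Icc m1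
  obtain ⟨i2, e2⟩ := integrable_and_integral_setIntegral_Icc (τ := volume)
    (h2.continuous_deriv le_rfl).integrableOn_Icc m2
  obtain ⟨i3, e3⟩ := integrable_and_integral_setIntegral_Icc (τ := volume)
    (continuous_mixedDeriv hu).integrableOn_Icc hμ
  rw [← e1, ← e2, ← e3, integral_map measurable_fst.aemeasurable i1.1,
    integral_map measurable_snd.aemeasurable i2.1]
  replace i1 : Integrable (fun x : ℝ × ℝ => ∫ s in Icc x.1 b.1, deriv (fun x => u (x, b.2)) s) μ :=
    i1.comp_measurable measurable_fst
  replace i2 : Integrable (fun x : ℝ × ℝ => ∫ t in Icc x.2 b.2, deriv (fun y => u (b.1, y)) t) μ :=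
    i2.comp_measurable measurable_snd
  have hae : u =ᵐ[μ] fun x => u b - (∫ s in Icc x.1 b.1, deriv (fun x => u (x, b.2)) s)
      - (∫ t in Icc x.2 b.2, deriv (fun y => u (b.1, y)) t) + ∫ p in Icc x b, mixedDeriv u p := by
    filter_upwards [hμ] with x hx
    rw [setIntegral_Icc_deriv h1 hx.2.1, setIntegral_Icc_deriv h2 hx.2.2,
      setIntegral_mixedDeriv hu hx.2]
    ring
  rw [integral_congr_ae hae, integral_add _ i3, integral_sub _ i2, integral_sub _ i1]
  · simp
  · exact integrable_const _
  · exact (integrable_const _).sub i1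
  · exact ((integrable_const _).sub i1).sub i2

end Utility

open Set in
theorem integral_lt_of_mDistDom2 {u : ℝ × ℝ → ℝ} (hu : ContDiff ℝ 2 u) (hmono : StrictlyMonoIncr2 u)
    (hmix : ∀ p, mixedDeriv u p ≤ 0) {μ ν : Measure (ℝ × ℝ)} [IsProbabilityMeasure μ]
    [IsProbabilityMeasure ν] {K : Set (ℝ × ℝ)} (hK : Bornology.IsBounded K)
    (hμK : ∀ᵐ x ∂μ, x ∈ K) (hνK : ∀ᵐ x ∂ν, x ∈ K) (hdom : mDistDom2 μ ν) :
    ∫ x, u x ∂ν < ∫ x, u x ∂μ := by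
  obtain ⟨hfsd, hstrict⟩ := hdom
  have hmarg1 : ∀ (ρ : Measure (ℝ × ℝ)) s, (ρ.map Prod.fst).real (Iic s) = mMargFst ρ s :=
    fun ρ s => map_measureReal_apply measurable_fst measurableSet_Iic
  have hmarg2 : ∀ (ρ : Measure (ℝ × ℝ)) s, (ρ.map Prod.snd).real (Iic s) = mMargSnd ρ s :=
    fun ρ s => map_measureReal_apply measurable_snd measurableSet_Iic
  obtain ⟨t, ht⟩ : ∃ t, mMargFst μ t < mMargFst ν t ∨ mMargSnd μ t < mMargSnd ν t := by
    rcases hstrict with ⟨-, t, ht⟩ | ⟨-, t, ht⟩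
    exacts [⟨t, .inl ht⟩, ⟨t, .inr ht⟩]
  obtain ⟨R, hR⟩ := hK.subset_closedBall 0
  obtain ⟨M, hM⟩ := exists_gt (max R |t|)
  have hRM : R < M := (le_max_left _ _).trans_lt hM
  obtain ⟨hMt, htM⟩ := abs_lt.1 ((le_max_right _ _).trans_lt hM)
  have hKI : K ⊆ Icc (-M, -M) (M, M) := fun x hx => by
    have h := hR hx
    rw [mem_closedBall_zero_iff, Prod.norm_def, max_le_iff, Real.norm_eq_abs, Real.norm_eq_abs,
      abs_le, abs_le] at h
    exact ⟨⟨by linarith [h.1.1], by linarith [h.2.1]⟩, ⟨by linarith [h.1.2], by linarith [h.2.2]⟩⟩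
  replace hμK := hμK.mono fun x hx => hKI hx
  replace hνK := hνK.mono fun x hx => hKI hx
  have hjoint1 : ∀ ρ : Measure (ℝ × ℝ), (∀ᵐ x ∂ρ, x ∈ Icc (-M, -M) (M, M)) →
      ∀ s, mMargFst ρ s = mJointCDF2 ρ (s, M) := fun ρ hρ s => by
    refine congrArg ENNReal.toReal (measure_congr ?_)
    filter_upwards [hρ] with x hx
    exact propext ⟨fun h => ⟨h, hx.2.2⟩, fun h => h.1⟩
  have hjoint2 : ∀ ρ : Measure (ℝ × ℝ), (∀ᵐ x ∂ρ, x ∈ Icc (-M, -M) (M, M)) →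
      ∀ s, mMargSnd ρ s = mJointCDF2 ρ (M, s) := fun ρ hρ s => by
    refine congrArg ENNReal.toReal (measure_congr ?_)
    filter_upwards [hρ] with x hx
    exact propext ⟨fun h => ⟨hx.2.1, h⟩, fun h => h.2⟩
  have hle1 : ∀ s, (μ.map Prod.fst).real (Iic s) ≤ (ν.map Prod.fst).real (Iic s) := fun s => by
    rw [hmarg1, hmarg1, hjoint1 μ hμK, hjoint1 ν hνK]
    exact hfsd _
  have hle2 : ∀ s, (μ.map Prod.snd).real (Iic s) ≤ (ν.map Prod.snd).real (Iic s) := fun s => by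
    rw [hmarg2, hmarg2, hjoint2 μ hμK, hjoint2 ν hνK]
    exact hfsd _
  have hc1 : ContDiff ℝ 1 fun x => u (x, M) :=
    (hu.of_le one_le_two).comp (contDiff_id.prodMk contDiff_const)
  have hc2 : ContDiff ℝ 1 fun y => u (M, y) :=
    (hu.of_le one_le_two).comp (contDiff_const.prodMk contDiff_id)
  have hm1 : StrictMono fun x => u (x, M) := fun x y h => hmono _ _ ⟨⟨h.le, le_rfl⟩, .inl h⟩
  have hm2 : StrictMono fun y => u (M, y) := fun x y h => hmono _ _ ⟨⟨le_rfl, h.le⟩, .inr h⟩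
  have pμ1 := Measure.isProbabilityMeasure_map (μ := μ) measurable_fst.aemeasurable
  have pν1 := Measure.isProbabilityMeasure_map (μ := ν) measurable_fst.aemeasurable
  have pμ2 := Measure.isProbabilityMeasure_map (μ := μ) measurable_snd.aemeasurable
  have pν2 := Measure.isProbabilityMeasure_map (μ := ν) measurable_snd.aemeasurable
  have hI1 := setIntegral_mul_cdf_mono (τ := volume) (a := -M) (b := M)
    (hc1.continuous_deriv le_rfl).integrableOn_Icc (fun s => hm1.monotone.deriv_nonneg)
    fun s _ => hle1 s
  have hI2 := setIntegral_mul_cdf_mono (τ := volume) (a := -M) (b := M)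
    (hc2.continuous_deriv le_rfl).integrableOn_Icc (fun s => hm2.monotone.deriv_nonneg)
    fun s _ => hle2 s
  have hI3 := setIntegral_mul_cdf_mono (τ := volume) (a := (-M, -M)) (b := (M, M))
    (h := fun s => -mixedDeriv u s) (continuous_mixedDeriv hu).neg.integrableOn_Icc
    (fun s => neg_nonneg.2 (hmix s))
    fun s _ => hfsd s
  simp only [neg_mul, integral_neg] at hI3
  rw [integral_eq_of_mem_Icc hu hμK, integral_eq_of_mem_Icc hu hνK]
  dsimp only
  rcases ht with ht | ht
  · rw [← hmarg1, ← hmarg1] at ht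
    have := setIntegral_deriv_mul_cdf_lt hc1 hm1 hle1 hMt.le htM ht
    linarith
  · rw [← hmarg2, ← hmarg2] at ht
    have := setIntegral_deriv_mul_cdf_lt hc2 hm2 hle2 hMt.le htM ht
    linarith

theorem isProbabilityMeasure_mixture {α ι : Type*} [MeasurableSpace α] [Fintype ι]
    (ρ : ι → Measure α) [∀ i, IsProbabilityMeasure (ρ i)] {l : ι → ℝ} (hl0 : ∀ i, 0 ≤ l i)
    (hl1 : ∑ i, l i = 1) : IsProbabilityMeasure (∑ i, ENNReal.ofReal (l i) • ρ i) := by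
  constructor
  simp [← ENNReal.ofReal_sum_of_nonneg fun i _ => hl0 i, hl1]

theorem ae_mixture {α ι : Type*} [MeasurableSpace α] [Fintype ι] {ρ : ι → Measure α}
    {c : ι → ENNReal} {P : α → Prop} (h : ∀ i, ∀ᵐ x ∂ρ i, P x) : ∀ᵐ x ∂(∑ i, c i • ρ i), P x := by
  rw [ae_iff]
  simp [fun i => ae_iff.1 (h i)]

theorem integral_mixture {α ι : Type*} [MeasurableSpace α] [Fintype ι] {ρ : ι → Measure α}
    {l : ι → ℝ} (hl0 : ∀ i, 0 ≤ l i) {f : α → ℝ} (hf : ∀ i, Integrable f (ρ i)) :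
    ∫ x, f x ∂(∑ i, ENNReal.ofReal (l i) • ρ i) = ∑ i, l i * ∫ x, f x ∂ρ i := by
  rw [integral_finsetSum_measure fun i _ => (hf i).smul_measure ENNReal.ofReal_ne_top]
  simp [integral_smul_measure, ENNReal.toReal_ofReal (hl0 _)]

/-- If some convex mixture of the laws of `X₁,…,Xₙ` distributionally dominates the same
mixture of the laws of `Y₁,…,Yₙ`, then for every strictly increasing, twice continuously
differentiable utility with nonpositive mixed partial derivative, some `Xᵢ` has strictly
greater expected utility than `Yᵢ`. -/
theorem stmt4 {Ω : Type*} [MeasureSpace Ω] [IsProbabilityMeasure (ℙ : Measure Ω)]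
    {n : ℕ} (X Y : Fin n → Ω → ℝ × ℝ)
    (hX : ∀ i, Measurable (X i)) (hY : ∀ i, Measurable (Y i))
    (hXc : ∀ i, ∃ K : Set (ℝ × ℝ), IsCompact K ∧ Measure.map (X i) ℙ Kᶜ = 0)
    (hYc : ∀ i, ∃ K : Set (ℝ × ℝ), IsCompact K ∧ Measure.map (Y i) ℙ Kᶜ = 0)
    (l : Fin n → ℝ) (hl0 : ∀ i, 0 ≤ l i) (hl1 : ∑ i, l i = 1)
    (hdom : mDistDom2 (∑ i, ENNReal.ofReal (l i) • Measure.map (X i) ℙ)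
                      (∑ i, ENNReal.ofReal (l i) • Measure.map (Y i) ℙ)) :
    ∀ u : ℝ × ℝ → ℝ, ContDiff ℝ 2 u → StrictlyMonoIncr2 u →
      (∀ a b : ℝ, deriv (fun x₁ => deriv (fun x₂ => u (x₁, x₂)) b) a ≤ 0) →
      ∃ i : Fin n, ∫ ω, u (Y i ω) ∂ℙ < ∫ ω, u (X i ω) ∂ℙ := by
  intro u hu hmono hmix
  choose K hK hXK using hXc
  choose L hL hYL using hYc
  have hXae : ∀ i, ∀ᵐ x ∂Measure.map (X i) ℙ, x ∈ K i := hXK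
  have hYae : ∀ i, ∀ᵐ x ∂Measure.map (Y i) ℙ, x ∈ L i := hYL
  have hXp i := Measure.isProbabilityMeasure_map (μ := (ℙ : Measure Ω)) (hX i).aemeasurable
  have hYp i := Measure.isProbabilityMeasure_map (μ := (ℙ : Measure Ω)) (hY i).aemeasurable
  have hint : ∀ (ρ : Measure (ℝ × ℝ)) [IsFiniteMeasure ρ] {S : Set (ℝ × ℝ)}, IsCompact S →
      (∀ᵐ x ∂ρ, x ∈ S) → Integrable u ρ := fun ρ _ S hS h => by
    rw [← Measure.restrict_eq_self_of_ae_mem h]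
    exact hu.continuous.continuousOn.integrableOn_compact hS
  have := isProbabilityMeasure_mixture (fun i => Measure.map (X i) ℙ) hl0 hl1
  have := isProbabilityMeasure_mixture (fun i => Measure.map (Y i) ℙ) hl0 hl1
  have hB : Bornology.IsBounded ((⋃ i, K i) ∪ ⋃ i, L i) :=
    ((isCompact_iUnion hK).union (isCompact_iUnion hL)).isBounded
  have hlt := integral_lt_of_mDistDom2 hu hmono (fun p => hmix p.1 p.2) hB
    (ae_mixture fun i => (hXae i).mono fun x hx => .inl (Set.mem_iUnion_of_mem i hx))
    (ae_mixture fun i => (hYae i).mono fun x hx => .inr (Set.mem_iUnion_of_mem i hx)) hdom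
  rw [integral_mixture hl0 fun i => hint _ (hK i) (hXae i),
    integral_mixture hl0 fun i => hint _ (hL i) (hYae i)] at hlt
  obtain ⟨i, -, hi⟩ := Finset.exists_lt_of_sum_lt hlt
  have hi' := lt_of_mul_lt_mul_left hi (hl0 i)
  rw [integral_map (hX i).aemeasurable hu.continuous.aestronglyMeasurable,
    integral_map (hY i).aemeasurable hu.continuous.aestronglyMeasurable] at hi'
  exact ⟨i, hi'⟩
end

section
/- Let Z^{π_1},…,Z^{π_n} be integrable random vectors taking values in ℝ^d. Fix j ∈ {1,…,n} and suppose there is no λ in the standard simplex Δⁿ such that Σ_{i=1}^n λ_i E[Z^{π_i}] Pareto dominates E[Z^{π_j}] (i.e., π_j belongs to the convex hull). Then there is no λ ∈ Δⁿ such that the mixture measure Σ_{i=1}^n λ_i · Law(Z^{π_i}) distributionally dominates Law(Z^{π_j}) (i.e., π_j belongs to the convex distributional undominated set). Hence the convex hull is a subset of the convex distributional undominated set. -/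
open MeasureTheory
open scoped ProbabilityTheory ENNReal

/-- Joint CDF of a measure on `ℝ^d`. -/
noncomputable def mJointCDF {d : ℕ} (μ : Measure (Fin d → ℝ)) (v : Fin d → ℝ) : ℝ :=
  (μ {x | ∀ i, x i ≤ v i}).toReal

/-- Marginal CDF of coordinate `i` of a measure on `ℝ^d`. -/
noncomputable def mMargCDF {d : ℕ} (μ : Measure (Fin d → ℝ)) (i : Fin d) (t : ℝ) : ℝ :=
  (μ {x | x i ≤ t}).toReal

/-- `μ` first-order stochastically dominates `ν`. -/
def mFSD {d : ℕ} (μ ν : Measure (Fin d → ℝ)) : Prop :=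
  ∀ v : Fin d → ℝ, mJointCDF μ v ≤ mJointCDF ν v

/-- The `i`-th marginal of `μ` strictly first-order stochastically dominates the `i`-th
marginal of `ν`. -/
def mMargStrictFSD {d : ℕ} (μ ν : Measure (Fin d → ℝ)) (i : Fin d) : Prop :=
  (∀ t : ℝ, mMargCDF μ i t ≤ mMargCDF ν i t) ∧ ∃ t : ℝ, mMargCDF μ i t < mMargCDF ν i t

/-- `μ` distributionally dominates `ν`. -/
def mDistDom {d : ℕ} (μ ν : Measure (Fin d → ℝ)) : Prop :=
  mFSD μ ν ∧ ∃ i : Fin d, mMargStrictFSD μ ν i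

section

open Filter Topology Set

theorem layer_eq_Ico_sub_Ico (x : ℝ) :
    (fun t : ℝ => (Ici (0 : ℝ)).indicator (fun _ => (1 : ℝ)) t - (Ici x).indicator (fun _ => 1) t)
      = fun t => (Ico 0 x).indicator (fun _ => (1 : ℝ)) t - (Ico x 0).indicator (fun _ => 1) t := by
  funext t
  by_cases h0 : 0 ≤ t <;> by_cases hx : x ≤ t <;>
    simp [indicator, h0, hx, ← not_le]

theorem integrable_Ico_one (a b : ℝ) :
    Integrable ((Ico a b).indicator fun _ => (1 : ℝ)) volume :=
  (integrable_indicator_iff measurableSet_Ico).2 (integrableOn_const (by simp))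

theorem integrable_layer (x : ℝ) :
    Integrable (fun t : ℝ =>
      (Ici (0 : ℝ)).indicator (fun _ => (1 : ℝ)) t - (Ici x).indicator (fun _ => 1) t) := by
  rw [layer_eq_Ico_sub_Ico]
  exact (integrable_Ico_one _ _).sub (integrable_Ico_one _ _)

theorem integral_layer (x : ℝ) :
    ∫ t : ℝ, ((Ici (0 : ℝ)).indicator (fun _ => (1 : ℝ)) t - (Ici x).indicator (fun _ => 1) t)
      = x := by
  rw [layer_eq_Ico_sub_Ico, integral_sub (integrable_Ico_one _ _) (integrable_Ico_one _ _),
    integral_indicator measurableSet_Ico, integral_indicator measurableSet_Ico]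
  rcases le_total 0 x with h | h <;> simp [h]

theorem integral_norm_layer (x : ℝ) :
    ∫ t : ℝ, ‖(Ici (0 : ℝ)).indicator (fun _ => (1 : ℝ)) t - (Ici x).indicator (fun _ => 1) t‖
      = |x| := by
  have h : (fun t : ℝ =>
      ‖(Ici (0 : ℝ)).indicator (fun _ => (1 : ℝ)) t - (Ici x).indicator (fun _ => 1) t‖)
      = fun t => (Ico 0 x).indicator (fun _ => (1 : ℝ)) t + (Ico x 0).indicator (fun _ => 1) t := by
    funext t
    by_cases h0 : 0 ≤ t <;> by_cases hx : x ≤ t <;>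
      simp [indicator, h0, hx, ← not_le]
  rw [h, integral_add (integrable_Ico_one _ _) (integrable_Ico_one _ _),
    integral_indicator measurableSet_Ico, integral_indicator measurableSet_Ico]
  rcases le_total 0 x with h | h <;> simp [h, abs_of_nonneg, abs_of_nonpos]

section Layer

variable {α : Type*} [MeasurableSpace α] {μ : Measure α} {f : α → ℝ}

theorem integrable_prod_layer (hf : Measurable f) (hi : Integrable f μ) :
    Integrable (fun p : α × ℝ => (Ici (0 : ℝ)).indicator (fun _ => (1 : ℝ)) p.2
      - (Ici (f p.1)).indicator (fun _ => 1) p.2) (μ.prod volume) := by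
  have hm : Measurable (fun p : α × ℝ => (Ici (0 : ℝ)).indicator (fun _ => (1 : ℝ)) p.2
      - (Ici (f p.1)).indicator (fun _ => 1) p.2) := by
    refine ((measurable_const.indicator measurableSet_Ici).comp measurable_snd).sub ?_
    exact Measurable.ite (p := fun p : α × ℝ => f p.1 ≤ p.2)
      (measurableSet_le (hf.comp measurable_fst) measurable_snd) measurable_const measurable_const
  rw [integrable_prod_iff hm.aestronglyMeasurable]
  refine ⟨Eventually.of_forall fun a => integrable_layer (f a), ?_⟩
  simp only [integral_norm_layer]
  exact hi.abs

variable [IsProbabilityMeasure μ]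

theorem integral_layer_left (hf : Measurable f) (t : ℝ) :
    ∫ a, ((Ici (0 : ℝ)).indicator (fun _ => (1 : ℝ)) t - (Ici (f a)).indicator (fun _ => 1) t) ∂μ
      = (Ici (0 : ℝ)).indicator (fun _ => (1 : ℝ)) t - μ.real {a | f a ≤ t} := by
  have hs : MeasurableSet {a | f a ≤ t} := measurableSet_le hf measurable_const
  have h : (fun a => (Ici (f a)).indicator (fun _ => (1 : ℝ)) t)
      = {a | f a ≤ t}.indicator fun _ => (1 : ℝ) := rfl
  rw [integral_sub (integrable_const _) (by rw [h]; exact (integrable_const _).indicator hs), h,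
    integral_indicator hs]
  simp

theorem integrable_sub_distribution (hf : Measurable f) (hi : Integrable f μ) :
    Integrable fun t : ℝ =>
      (Ici (0 : ℝ)).indicator (fun _ => (1 : ℝ)) t - μ.real {a | f a ≤ t} := by
  simpa only [integral_layer_left hf] using (integrable_prod_layer hf hi).integral_prod_right

theorem integral_sub_distribution (hf : Measurable f) (hi : Integrable f μ) :
    ∫ t : ℝ, ((Ici (0 : ℝ)).indicator (fun _ => (1 : ℝ)) t - μ.real {a | f a ≤ t})
      = ∫ a, f a ∂μ := by
  have h := integral_integral_swap (f := fun a t => (Ici (0 : ℝ)).indicator (fun _ => (1 : ℝ)) t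
      - (Ici (f a)).indicator (fun _ => 1) t) (integrable_prod_layer hf hi)
  simpa only [integral_layer_left hf, integral_layer] using h.symm

variable {β : Type*} [MeasurableSpace β] {ν : Measure β} [IsProbabilityMeasure ν] {g : β → ℝ}

/-- First-order stochastic dominance implies the inequality between expectations. -/
theorem integral_le_of_distribution_le (hf : Measurable f) (hfi : Integrable f μ)
    (hg : Measurable g) (hgi : Integrable g ν)
    (h : ∀ t, μ.real {a | f a ≤ t} ≤ ν.real {b | g b ≤ t}) :
    ∫ b, g b ∂ν ≤ ∫ a, f a ∂μ := by
  rw [← integral_sub_distribution hf hfi, ← integral_sub_distribution hg hgi]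
  exact integral_mono (integrable_sub_distribution hg hgi) (integrable_sub_distribution hf hfi)
    fun t => sub_le_sub_left (h t) _

theorem continuousWithinAt_distribution (hf : Measurable f) (t : ℝ) :
    ContinuousWithinAt (fun s => μ.real {a | f a ≤ s}) (Ici t) t := by
  have : IsProbabilityMeasure (μ.map f) := Measure.isProbabilityMeasure_map hf.aemeasurable
  have h : (fun s => μ.real {a | f a ≤ s}) = ProbabilityTheory.cdf (μ.map f) := by
    funext s
    rw [ProbabilityTheory.cdf_eq_real, map_measureReal_apply hf measurableSet_Iic]
    rfl
  rw [h]
  exact (ProbabilityTheory.cdf (μ.map f)).right_continuous t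

/-- Strict first-order stochastic dominance implies the strict inequality between expectations. -/
theorem integral_lt_of_distribution_lt (hf : Measurable f) (hfi : Integrable f μ)
    (hg : Measurable g) (hgi : Integrable g ν)
    (h : ∀ t, μ.real {a | f a ≤ t} ≤ ν.real {b | g b ≤ t})
    (hlt : ∃ t, μ.real {a | f a ≤ t} < ν.real {b | g b ≤ t}) :
    ∫ b, g b ∂ν < ∫ a, f a ∂μ := by
  obtain ⟨t, ht⟩ := hlt
  have hev : ∀ᶠ s in 𝓝[≥] t, μ.real {a | f a ≤ s} < ν.real {b | g b ≤ s} := by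
    filter_upwards [(continuousWithinAt_distribution (μ := μ) hf t).eventually_lt_const ht,
      self_mem_nhdsWithin] with s hs hts
    exact hs.trans_le (measureReal_mono (ofPred_subset_ofPred.2 fun b hb => hb.trans hts))
  obtain ⟨u, htu, hu⟩ := mem_nhdsGE_iff_exists_Ico_subset.1 hev
  have hF := integrable_sub_distribution hf hfi
  have hG := integrable_sub_distribution hg hgi
  rw [← sub_pos, ← integral_sub_distribution hf hfi, ← integral_sub_distribution hg hgi,
    ← integral_sub hF hG]
  refine (integral_pos_iff_support_of_nonneg ?_ (hF.sub hG)).2 ?_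
  · intro s
    have := h s
    simp only [Pi.zero_apply, Pi.sub_apply]
    linarith
  · refine lt_of_lt_of_le ?_ (measure_mono (s := Ico t u) fun s hs => ?_)
    · simpa using htu
    · have := hu hs
      simp only [mem_ofPred_eq] at this
      simp only [Function.mem_support, Pi.sub_apply]
      linarith

end Layer

theorem tendsto_mJointCDF_update {d : ℕ} (μ : Measure (Fin d → ℝ)) [IsFiniteMeasure μ]
    (i : Fin d) (t : ℝ) :
    Tendsto (fun m : ℕ => mJointCDF μ (Function.update (fun _ => (m : ℝ)) i t)) atTop
      (𝓝 (mMargCDF μ i t)) := by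
  have hU : {x : Fin d → ℝ | x i ≤ t}
      = ⋃ m : ℕ, {x | ∀ k, x k ≤ Function.update (fun _ => (m : ℝ)) i t k} := by
    ext x
    simp only [mem_ofPred_eq, mem_iUnion]
    constructor
    · intro hx
      obtain ⟨m, hm⟩ := exists_nat_ge (∑ k, |x k|)
      refine ⟨m, fun k => ?_⟩
      rcases eq_or_ne k i with rfl | hk
      · simpa using hx
      · rw [Function.update_of_ne hk]
        exact (le_abs_self _).trans
          ((Finset.single_le_sum (fun k _ => abs_nonneg (x k)) (Finset.mem_univ k)).trans hm)
    · rintro ⟨m, hm⟩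
      simpa using hm i
  have hmono : Monotone fun m : ℕ =>
      {x : Fin d → ℝ | ∀ k, x k ≤ Function.update (fun _ => (m : ℝ)) i t k} := by
    intro m m' hm x hx k
    refine (hx k).trans ?_
    rcases eq_or_ne k i with rfl | hk
    · simp
    · simpa [Function.update_of_ne hk] using hm
  unfold mJointCDF mMargCDF
  rw [hU]
  exact (ENNReal.tendsto_toReal (measure_ne_top _ _)).comp (tendsto_measure_iUnion_atTop hmono)

theorem mFSD.mMargCDF_le {d : ℕ} {μ ν : Measure (Fin d → ℝ)} [IsFiniteMeasure μ]
    [IsFiniteMeasure ν] (h : mFSD μ ν) (i : Fin d) (t : ℝ) :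
    mMargCDF μ i t ≤ mMargCDF ν i t :=
  le_of_tendsto_of_tendsto' (tendsto_mJointCDF_update μ i t) (tendsto_mJointCDF_update ν i t)
    fun _ => h _

/-- Distributional dominance implies Pareto dominance of the expectations. -/
theorem mDistDom.paretoDom {d : ℕ} {μ ν : Measure (Fin d → ℝ)} [IsProbabilityMeasure μ]
    [IsProbabilityMeasure ν] (hμ : ∀ i, Integrable (fun x => x i) μ)
    (hν : ∀ i, Integrable (fun x => x i) ν) (h : mDistDom μ ν) :
    ParetoDom (fun i => ∫ x, x i ∂μ) (fun i => ∫ x, x i ∂ν) := by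
  obtain ⟨hF, i, hle, hlt⟩ := h
  exact ⟨fun k => integral_le_of_distribution_le (measurable_pi_apply k) (hμ k)
      (measurable_pi_apply k) (hν k) (hF.mMargCDF_le k),
    i, integral_lt_of_distribution_lt (measurable_pi_apply i) (hμ i)
      (measurable_pi_apply i) (hν i) hle hlt⟩

end

/-- If no convex combination of the expected returns of `Z^{π_1},…,Z^{π_n}` Pareto dominates
the expected return of `Z^{π_j}` (i.e. `π_j` is in the convex hull), then no convex mixture
of their laws distributionally dominates the law of `Z^{π_j}` (i.e. `π_j` is in the convex
distributional undominated set): the convex hull is a subset of the CDUS. -/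
theorem stmt5 {Ω : Type*} [MeasureSpace Ω] [IsProbabilityMeasure (ℙ : Measure Ω)]
    {d n : ℕ} (Z : Fin n → Ω → Fin d → ℝ)
    (hZm : ∀ k, Measurable (Z k)) (hZi : ∀ k, Integrable (Z k) ℙ)
    (j : Fin n)
    (hch : ¬ ∃ l : Fin n → ℝ, (∀ k, 0 ≤ l k) ∧ (∑ k, l k = 1) ∧
      ParetoDom (fun i => ∑ k, l k * ∫ ω, Z k ω i ∂ℙ) (fun i => ∫ ω, Z j ω i ∂ℙ)) :
    ¬ ∃ l : Fin n → ℝ, (∀ k, 0 ≤ l k) ∧ (∑ k, l k = 1) ∧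
      mDistDom (∑ k, ENNReal.ofReal (l k) • Measure.map (Z k) ℙ)
        (Measure.map (Z j) ℙ) := by
  rintro ⟨l, hl, hsum, hdom⟩
  refine hch ⟨l, hl, hsum, ?_⟩
  have hP (k : Fin n) : IsProbabilityMeasure (Measure.map (Z k) ℙ) :=
    Measure.isProbabilityMeasure_map (hZm k).aemeasurable
  have hM : IsProbabilityMeasure (∑ k, ENNReal.ofReal (l k) • Measure.map (Z k) ℙ) := by
    constructor
    simp [Measure.finsetSum_apply, ← ENNReal.ofReal_sum_of_nonneg fun k _ => hl k, hsum]
  have hint (k : Fin n) (i : Fin d) : Integrable (fun x => x i) (Measure.map (Z k) ℙ) :=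
    (integrable_map_measure (measurable_pi_apply i).aestronglyMeasurable
      (hZm k).aemeasurable).2 ((hZi k).eval i)
  have hints (k : Fin n) (i : Fin d) :
      Integrable (fun x => x i) (ENNReal.ofReal (l k) • Measure.map (Z k) ℙ) :=
    (hint k i).smul_measure ENNReal.ofReal_ne_top
  have hmap (k : Fin n) (i : Fin d) : ∫ x, x i ∂(Measure.map (Z k) ℙ) = ∫ ω, Z k ω i ∂ℙ :=
    integral_map (hZm k).aemeasurable (measurable_pi_apply i).aestronglyMeasurable
  have hmix (i : Fin d) : ∫ x, x i ∂(∑ k, ENNReal.ofReal (l k) • Measure.map (Z k) ℙ)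
      = ∑ k, l k * ∫ ω, Z k ω i ∂ℙ := by
    rw [integral_finsetSum_measure fun k _ => hints k i]
    refine Finset.sum_congr rfl fun k _ => ?_
    rw [integral_smul_measure, hmap, ENNReal.toReal_ofReal (hl k), smul_eq_mul]
  have h := hdom.paretoDom
    (fun i => integrable_finsetSum_measure.2 fun k _ => hints k i) (hint j)
  simpa only [hmix, hmap] using h
end

section
/- Let X and Y be random vectors taking values in ℝ^d. Suppose that for every strictly monotonically increasing measurable function u : ℝ^d → ℝ such that u∘X and u∘Y are integrable, we have E[u(X)] ≥ E[u(Y)]. Then X first-order stochastically dominates Y, i.e. F_X(v) ≤ F_Y(v) for all v ∈ ℝ^d. -/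
open MeasureTheory
open scoped ProbabilityTheory

/-- A bounded measurable strictly increasing utility: a small strictly increasing perturbation of
minus the indicator of the lower orthant at `v`. -/
noncomputable def orthantUtility {d : ℕ} (v : Fin d → ℝ) (ε : ℝ) (x : Fin d → ℝ) : ℝ :=
  ε * ∑ i, Real.arctan (x i) - (Set.Iic v).indicator 1 x

theorem measurable_orthantUtility {d : ℕ} (v : Fin d → ℝ) (ε : ℝ) :
    Measurable (orthantUtility v ε) := by
  have : Measurable ((Set.Iic v).indicator (1 : (Fin d → ℝ) → ℝ)) :=
    measurable_one.indicator measurableSet_Iic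
  unfold orthantUtility
  fun_prop

theorem strictlyMonoIncr_orthantUtility {d : ℕ} (v : Fin d → ℝ) {ε : ℝ} (hε : 0 < ε) :
    StrictlyMonoIncr (orthantUtility v ε) := by
  rintro x y ⟨hle, j, hj⟩
  have hsum : ∑ i, Real.arctan (y i) < ∑ i, Real.arctan (x i) :=
    Finset.sum_lt_sum (fun i _ => Real.arctan_strictMono.monotone (hle i))
      ⟨j, Finset.mem_univ j, Real.arctan_strictMono hj⟩
  have hind : (Set.Iic v).indicator (1 : (Fin d → ℝ) → ℝ) x ≤ (Set.Iic v).indicator 1 y := by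
    by_cases hx : x ∈ Set.Iic v
    · have hy : y ∈ Set.Iic v := le_trans (show y ≤ x from hle) hx
      simp [Set.indicator_of_mem hx, Set.indicator_of_mem hy]
    · rw [Set.indicator_of_notMem hx]
      exact Set.indicator_nonneg (fun _ _ => zero_le_one) y
  have := mul_lt_mul_of_pos_left hsum hε
  unfold orthantUtility
  linarith

theorem integrable_sum_arctan {Ω : Type*} [MeasurableSpace Ω] {μ : Measure Ω} [IsFiniteMeasure μ]
    {d : ℕ} {X : Ω → Fin d → ℝ} (hX : Measurable X) :
    Integrable (fun ω => ∑ i, Real.arctan (X ω i)) μ := by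
  refine integrable_finsetSum _ fun i _ => ?_
  refine Integrable.of_bound (C := Real.pi / 2)
    (Real.measurable_arctan.comp ((measurable_pi_apply i).comp hX)).aestronglyMeasurable
    (Filter.Eventually.of_forall fun ω => ?_)
  rw [Real.norm_eq_abs, abs_le]
  exact ⟨(Real.neg_pi_div_two_lt_arctan _).le, (Real.arctan_lt_pi_div_two _).le⟩

theorem integrable_indicator_Iic_comp {Ω : Type*} [MeasurableSpace Ω] {μ : Measure Ω}
    [IsFiniteMeasure μ] {d : ℕ} {X : Ω → Fin d → ℝ} (hX : Measurable X) (v : Fin d → ℝ) :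
    Integrable (fun ω => (Set.Iic v).indicator (1 : (Fin d → ℝ) → ℝ) (X ω)) μ :=
  (integrable_const (1 : ℝ)).indicator (hX measurableSet_Iic)

theorem integrable_orthantUtility_comp {Ω : Type*} [MeasurableSpace Ω] {μ : Measure Ω}
    [IsFiniteMeasure μ] {d : ℕ} {X : Ω → Fin d → ℝ} (hX : Measurable X) (v : Fin d → ℝ) (ε : ℝ) :
    Integrable (orthantUtility v ε ∘ X) μ :=
  ((integrable_sum_arctan hX).const_mul ε).sub (integrable_indicator_Iic_comp hX v)

theorem integral_orthantUtility {Ω : Type*} [MeasureSpace Ω] [IsFiniteMeasure (ℙ : Measure Ω)]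
    {d : ℕ} {X : Ω → Fin d → ℝ} (hX : Measurable X) (v : Fin d → ℝ) (ε : ℝ) :
    ∫ ω, orthantUtility v ε (X ω) ∂ℙ =
      ε * ∫ ω, ∑ i, Real.arctan (X ω i) ∂ℙ - jointCDF X v := by
  have hcdf : ∫ ω, (Set.Iic v).indicator (1 : (Fin d → ℝ) → ℝ) (X ω) ∂ℙ = jointCDF X v :=
    integral_indicator_one (hX measurableSet_Iic)
  unfold orthantUtility
  rw [integral_sub ((integrable_sum_arctan hX).const_mul ε) (integrable_indicator_Iic_comp hX v),
    integral_const_mul, hcdf]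

/-- If every strictly monotonically increasing measurable utility (integrable against both
laws) has expectation under `X` at least that under `Y`, then `X` first-order stochastically
dominates `Y`. -/
theorem stmt6 {Ω : Type*} [MeasureSpace Ω] [IsProbabilityMeasure (ℙ : Measure Ω)]
    {d : ℕ} (X Y : Ω → Fin d → ℝ)
    (hX : Measurable X) (hY : Measurable Y)
    (h : ∀ u : (Fin d → ℝ) → ℝ, Measurable u → StrictlyMonoIncr u →
      Integrable (u ∘ X) ℙ → Integrable (u ∘ Y) ℙ →
      ∫ ω, u (Y ω) ∂ℙ ≤ ∫ ω, u (X ω) ∂ℙ) :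
    FSD X Y := by
  intro v
  set a := ∫ ω, ∑ i, Real.arctan (X ω i) ∂ℙ
  set b := ∫ ω, ∑ i, Real.arctan (Y ω i) ∂ℙ
  have key : ∀ ε : ℝ, 0 < ε → jointCDF X v ≤ jointCDF Y v + ε * (a - b) := by
    intro ε hε
    have hu := h _ (measurable_orthantUtility v ε) (strictlyMonoIncr_orthantUtility v hε)
      (integrable_orthantUtility_comp hX v ε) (integrable_orthantUtility_comp hY v ε)
    rw [integral_orthantUtility hX, integral_orthantUtility hY] at hu
    linarith
  refine le_of_forall_pos_le_add fun δ hδ => ?_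
  have hc : 0 < |a - b| + 1 := by positivity
  have hbound : δ / (|a - b| + 1) * (a - b) ≤ δ := by
    rw [div_mul_eq_mul_div, div_le_iff₀ hc]
    exact mul_le_mul_of_nonneg_left ((le_abs_self _).trans (by linarith)) hδ.le
  linarith [key _ (div_pos hδ hc)]
end

section
/- There exist random vectors X and Y taking values in ℝ² and a strictly monotonically increasing continuous function u : ℝ² → ℝ such that X first-order stochastically dominates Y (F_X(v) ≤ F_Y(v) for all v) but E[u(X)] < E[u(Y)]. (For instance, X taking value (2,4) with probability 2/3 and (4,2) with probability 1/3, Y taking values (2,2), (2,4), (4,4) each with probability 1/3, and u(v₁,v₂) = ln(1 + e^{v₁}) · ln(1 + e^{v₂}).) -/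
open MeasureTheory
open scoped ProbabilityTheory ENNReal

/-- The fair coin on `Bool`. -/
noncomputable def fairCoin : Measure Bool :=
  (2⁻¹ : ℝ≥0∞) • Measure.dirac true + (2⁻¹ : ℝ≥0∞) • Measure.dirac false

instance : IsProbabilityMeasure fairCoin :=
  ⟨by simp [fairCoin, ENNReal.inv_two_add_inv_two]⟩

lemma fairCoin_real_setOf (p : Bool → Prop) [DecidablePred p] :
    (fairCoin {ω | p ω}).toReal = (if p true then 2⁻¹ else 0) + (if p false then 2⁻¹ else 0) := by
  by_cases ht : p true <;> by_cases hf : p false <;>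
    simp [fairCoin, ht, hf, ENNReal.inv_two_add_inv_two]
  norm_num

lemma integral_fairCoin (f : Bool → ℝ) : ∫ ω, f ω ∂fairCoin = 2⁻¹ * f true + 2⁻¹ * f false := by
  rw [fairCoin, integral_add_measure (Integrable.of_finite.smul_measure (by simp))
    (Integrable.of_finite.smul_measure (by simp))]
  simp

lemma strictlyMonoIncr2_exp_add : StrictlyMonoIncr2 fun v => Real.exp (v.1 + v.2) := by
  rintro x y ⟨⟨h₁, h₂⟩, h | h⟩ <;> exact Real.exp_lt_exp.2 (by linarith)

/-- First-order stochastic dominance of multivariate distributions does not imply greater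
expected utility for all strictly monotonically increasing (continuous) utilities. -/
theorem stmt9 :
    ∃ (Ω : Type) (_ : MeasureSpace Ω) (_ : IsProbabilityMeasure (ℙ : Measure Ω))
      (X Y : Ω → ℝ × ℝ) (u : ℝ × ℝ → ℝ),
      Measurable X ∧ Measurable Y ∧
      Continuous u ∧ StrictlyMonoIncr2 u ∧
      FSD2 X Y ∧
      ∫ ω, u (X ω) ∂ℙ < ∫ ω, u (Y ω) ∂ℙ := by
  let inst : MeasureSpace Bool := ⟨fairCoin⟩
  refine ⟨Bool, inst, inferInstanceAs (IsProbabilityMeasure fairCoin),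
    fun ω => if ω then (0, 1) else (1, 0), fun ω => if ω then (1, 1) else (0, 0),
    fun v => Real.exp (v.1 + v.2), measurable_of_finite _, measurable_of_finite _, by fun_prop,
    strictlyMonoIncr2_exp_add, ?_, ?_⟩
  · rintro ⟨a, b⟩
    classical
    refine (fairCoin_real_setOf _).trans_le (le_of_le_of_eq ?_ (fairCoin_real_setOf _).symm)
    simp only [if_true, Bool.false_eq_true, if_false]
    split_ifs <;> first | (exfalso; grind) | norm_num
  · refine (integral_fairCoin _).trans_lt (lt_of_lt_of_eq ?_ (integral_fairCoin _).symm)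
    have h : Real.exp (1 + 1) = Real.exp 1 * Real.exp 1 := Real.exp_add 1 1
    have h₁ : 1 < Real.exp 1 := Real.one_lt_exp_iff.2 one_pos
    simp only [if_true, Bool.false_eq_true, if_false, zero_add, add_zero, Real.exp_zero, h]
    nlinarith [mul_pos (sub_pos.2 h₁) (sub_pos.2 h₁)]
end

section
/- There exist three finitely supported probability measures μ₁, μ₂, μ₃ on ℝ² such that: (1) no μ_j's mean Pareto dominates another μ_k's mean, so all three belong to the Pareto front of the family; but (2) the mixture (1/2)μ₁ + (1/2)μ₂ distributionally dominates μ₃, so μ₃ does not belong to the convex distributional undominated set. Hence the Pareto front is not in general a subset of the convex distributional undominated set. (For instance, μ₁ the point mass at (1,5), μ₂ the point mass at (5,1), and μ₃ placing probability 1/2 on each of (1,3) and (3,1).) -/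
open MeasureTheory
open scoped ProbabilityTheory ENNReal

/-- The uniform mixture of two point masses. -/
noncomputable def diracMix (p q : ℝ × ℝ) : Measure (ℝ × ℝ) :=
  (1 / 2 : ℝ≥0∞) • Measure.dirac p + (1 / 2 : ℝ≥0∞) • Measure.dirac q

open Classical in
lemma diracMix_toReal (p q : ℝ × ℝ) (S : Set (ℝ × ℝ)) :
    (diracMix p q S).toReal = (if p ∈ S then 1 / 2 else 0) + (if q ∈ S then 1 / 2 else 0) := by
  by_cases hp : p ∈ S <;> by_cases hq : q ∈ S <;>
    simp [diracMix, hp, hq, ENNReal.inv_two_add_inv_two] <;> norm_num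

instance isProbabilityMeasure_diracMix (p q : ℝ × ℝ) : IsProbabilityMeasure (diracMix p q) :=
  ⟨by simp [diracMix, ENNReal.inv_two_add_inv_two]⟩

lemma diracMix_compl_pair (p q : ℝ × ℝ) :
    diracMix p q (↑({p, q} : Finset (ℝ × ℝ)))ᶜ = 0 := by
  simp [diracMix]

lemma integral_diracMix (p q : ℝ × ℝ) (f : ℝ × ℝ → ℝ) :
    ∫ x, f x ∂diracMix p q = (f p + f q) / 2 := by
  have hi (a : ℝ × ℝ) : Integrable f ((1 / 2 : ℝ≥0∞) • Measure.dirac a) :=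
    (integrable_dirac (by simp)).smul_measure (by simp)
  rw [diracMix, integral_add_measure (hi p) (hi q), integral_smul_measure, integral_smul_measure,
    integral_dirac, integral_dirac]
  simp
  ring

lemma mMean_dirac (p : ℝ × ℝ) : mMean (Measure.dirac p) = p := by
  simp [mMean]

lemma mMean_diracMix (p q : ℝ × ℝ) :
    mMean (diracMix p q) = ((p.1 + q.1) / 2, (p.2 + q.2) / 2) := by
  simp only [mMean, integral_diracMix]

lemma mDistDom2_diracMix : mDistDom2 (diracMix (1, 5) (5, 1)) (diracMix (1, 3) (3, 1)) := by
  refine ⟨fun v => ?_, Or.inl ⟨fun t => ?_, 3, ?_⟩⟩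
  · simp only [mJointCDF2, diracMix_toReal, Set.mem_ofPred_eq]
    split_ifs <;> grind
  · simp only [mMargFst, diracMix_toReal, Set.mem_ofPred_eq]
    split_ifs <;> grind
  · simp only [mMargFst, diracMix_toReal, Set.mem_ofPred_eq]
    norm_num

/-- There are three finitely supported probability measures on `ℝ²` whose means are pairwise
Pareto-undominated (so all belong to the Pareto front), while the uniform mixture of the
first two distributionally dominates the third (so it is not in the convex distributional
undominated set): the Pareto front need not be a subset of the CDUS. -/
theorem stmt13 :
    ∃ μ : Fin 3 → Measure (ℝ × ℝ),
      (∀ i, IsProbabilityMeasure (μ i)) ∧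
      (∀ i, ∃ s : Finset (ℝ × ℝ), μ i (↑s)ᶜ = 0) ∧
      (∀ j k : Fin 3, ¬ ParetoDom2 (mMean (μ j)) (mMean (μ k))) ∧
      mDistDom2 ((1 / 2 : ℝ≥0∞) • μ 0 + (1 / 2 : ℝ≥0∞) • μ 1) (μ 2) := by
  refine ⟨![Measure.dirac (1, 5), Measure.dirac (5, 1), diracMix (1, 3) (3, 1)],
    fun i => ?_, fun i => ?_, fun j k => ?_, mDistDom2_diracMix⟩
  · fin_cases i
    · exact Measure.dirac.isProbabilityMeasure
    · exact Measure.dirac.isProbabilityMeasure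
    · exact isProbabilityMeasure_diracMix _ _
  · fin_cases i
    · exact ⟨{(1, 5)}, by simp⟩
    · exact ⟨{(5, 1)}, by simp⟩
    · exact ⟨{(1, 3), (3, 1)}, diracMix_compl_pair _ _⟩
  · fin_cases j <;> fin_cases k <;>
      simp [ParetoDom2, mMean_dirac, mMean_diracMix] <;> norm_num
end

section
/- There exist two finitely supported probability measures μ₁ and μ₂ on ℝ² such that: (1) the mean of μ₁ Pareto dominates the mean of μ₂, so μ₂ does not belong to the Pareto front of the family {μ₁, μ₂}; but (2) no convex mixture λμ₁ + (1−λ)μ₂ with λ ∈ [0,1] distributionally dominates μ₂, so μ₂ belongs to the convex distributional undominated set. Hence the convex distributional undominated set is not in general a subset of the Pareto front. (For instance, μ₁ the point mass at (2,5) and μ₂ placing probability 1/2 on each of (1,5) and (3,3).) -/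
open MeasureTheory
open scoped ProbabilityTheory ENNReal

/-- There are two finitely supported probability measures on `ℝ²` such that the mean of the
first Pareto dominates the mean of the second (so the second is not on the Pareto front),
yet no convex mixture of the two distributionally dominates the second (so it belongs to the
convex distributional undominated set): the CDUS need not be a subset of the Pareto front. -/
theorem stmt14 :
    ∃ μ₁ μ₂ : Measure (ℝ × ℝ),
      IsProbabilityMeasure μ₁ ∧ IsProbabilityMeasure μ₂ ∧
      (∃ s : Finset (ℝ × ℝ), μ₁ (↑s)ᶜ = 0) ∧
      (∃ s : Finset (ℝ × ℝ), μ₂ (↑s)ᶜ = 0) ∧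
      ParetoDom2 (mMean μ₁) (mMean μ₂) ∧
      ∀ l : ℝ, 0 ≤ l → l ≤ 1 →
        ¬ mDistDom2 (ENNReal.ofReal l • μ₁ + ENNReal.ofReal (1 - l) • μ₂) μ₂ := by
  refine ⟨.dirac (2, 5), (2⁻¹ : ℝ≥0∞) • .dirac (1, 5) + (2⁻¹ : ℝ≥0∞) • .dirac (3, 3),
    inferInstance, ⟨by simp [ENNReal.inv_two_add_inv_two]⟩,
    ⟨{(2, 5)}, by simp⟩, ⟨{(1, 5), (3, 3)}, by simp⟩, ?_, ?_⟩
  · have integrable_half_dirac (f : ℝ × ℝ → ℝ) (a : ℝ × ℝ) :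
        Integrable f ((2⁻¹ : ℝ≥0∞) • .dirac a) :=
      (integrable_dirac (by finiteness)).smul_measure (by simp)
    simp only [ParetoDom2, mMean]
    rw [integral_add_measure (integrable_half_dirac _ _) (integrable_half_dirac _ _),
      integral_add_measure (integrable_half_dirac _ _) (integrable_half_dirac _ _)]
    norm_num
  · rintro l hl0 hl1 ⟨hfsd, hstrict⟩
    rcases hl0.eq_or_lt with rfl | hl
    · simp [StrictFSDcdf] at hstrict
    · have hset : MeasurableSet {x : ℝ × ℝ | x.1 ≤ 2 ∧ x.2 ≤ 5} := by measurability
      have h := hfsd (2, 5)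
      simp only [mJointCDF2, Measure.add_apply, Measure.smul_apply, smul_eq_mul,
        Measure.dirac_apply' _ hset] at h
      norm_num [Set.indicator] at h
      rw [ENNReal.toReal_add (by finiteness) (by finiteness)] at h
      simp [ENNReal.toReal_ofReal hl0, ENNReal.toReal_ofReal (sub_nonneg.2 hl1)] at h
      linarith
end
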